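/- arXiv:1601.07813 — 6 statements merged into one kernel-verified Lean document; each statement's English description precedes it below -/
import Mathlib

section
/- For every integer r with r ≥ 3 and r ≠ 5, every r-regular graph admits a zero-sum 5-flow. -/
/-- A finite undirected multigraph without loops: `E` indexes the edges, and each
edge has an unordered pair of distinct endpoints (parallel edges are allowed). -/
structure Multigraph (V : Type*) (E : Type*) where
  ends : E → Sym2 V
  loopless : ∀ e, ¬ (ends e).IsDiag

namespace Multigraph

variable {V E : Type*}

/-- The edges incident with a vertex `v`. -/
def incidence (G : Multigraph V E) [Fintype E] [DecidableEq V] (v : V) : Finset E :=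
  Finset.univ.filter fun e => v ∈ G.ends e

/-- The degree of a vertex `v`. -/
def degree (G : Multigraph V E) [Fintype E] [DecidableEq V] (v : V) : ℕ :=
  (G.incidence v).card

/-- The degree of a vertex `v` in the spanning subgraph with edge set `F`. -/
def degIn (G : Multigraph V E) [Fintype E] [DecidableEq V] (F : Finset E) (v : V) : ℕ :=
  (F.filter fun e => v ∈ G.ends e).card

/-- The simple graph on `V` whose adjacencies are realised by the edges in `F`;
used to speak about reachability/connectivity in the subgraph with edge set `F`. -/
def supportGraph (G : Multigraph V E) (F : Set E) : SimpleGraph V where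
  Adj v w := v ≠ w ∧ ∃ e ∈ F, G.ends e = s(v, w)
  symm := by
    constructor
    rintro v w ⟨hvw, e, he, hee⟩
    refine ⟨hvw.symm, e, he, ?_⟩
    rwa [Sym2.eq_swap]
  loopless := by constructor; rintro v ⟨h, -⟩; exact h rfl

/-- A zero-sum flow: nonzero integer values on the edges summing to zero at
every vertex. -/
def IsZeroSumFlow (G : Multigraph V E) [Fintype E] [DecidableEq V] (f : E → ℤ) : Prop :=
  (∀ e, f e ≠ 0) ∧ ∀ v, ∑ e ∈ G.incidence v, f e = 0

/-- A zero-sum `k`-flow: a zero-sum flow with values in `{±1, …, ±(k-1)}`. -/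
def IsZeroSumKFlow (G : Multigraph V E) [Fintype E] [DecidableEq V] (k : ℕ) (f : E → ℤ) : Prop :=
  G.IsZeroSumFlow f ∧ ∀ e, |f e| ≤ (k : ℤ) - 1

end Multigraph

/-- If a graph of even order has no perfect matching, then deleting some set `U` of vertices leaves
at least `|U| + 2` odd components. -/
theorem SimpleGraph.exists_barrier_of_no_perfectMatching {T : Type*} [Fintype T] [DecidableEq T]
    (H : SimpleGraph T) (hT : Even (Fintype.card T))
    (hno : ∀ M : H.Subgraph, ¬ M.IsPerfectMatching) :
    ∃ (U : Finset T) (C : Finset (Finset T)), U.card + 2 ≤ C.card ∧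
      (∀ S ∈ C, Odd S.card ∧ (∀ x ∈ S, x ∉ U) ∧ ∀ x ∈ S, ∀ y, H.Adj x y → y ∉ U → y ∈ S) ∧
      (C : Set (Finset T)).PairwiseDisjoint id := by
  classical
  obtain ⟨u, hu⟩ : ∃ u, H.IsTutteViolator u := by
    by_contra! h
    obtain ⟨M, hM⟩ := SimpleGraph.tutte.mpr h
    exact hno M hM
  unfold SimpleGraph.IsTutteViolator at hu
  set K := ((⊤ : H.Subgraph).deleteVerts u).coe with hK
  have hcard : Nat.card ((⊤ : H.Subgraph).deleteVerts u).verts + u.ncard = Fintype.card T := by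
    rw [Nat.card_coe_set_eq, SimpleGraph.Subgraph.deleteVerts_verts, SimpleGraph.Subgraph.verts_top,
      Set.ncard_sdiff_add_ncard_of_subset (Set.subset_univ _), Set.ncard_univ,
      Nat.card_eq_fintype_card]
  have hpar := K.odd_ncard_oddComponents
  have hle : u.ncard + 2 ≤ K.oddComponents.ncard := by
    rw [Nat.odd_iff, Nat.odd_iff] at hpar
    rw [Nat.even_iff] at hT
    omega
  let φ : K.ConnectedComponent → Finset T := fun c => (Set.image Subtype.val c.supp).toFinset
  have hφ : ∀ c x, x ∈ φ c ↔ ∃ h : x ∈ ((⊤ : H.Subgraph).deleteVerts u).verts,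
      K.connectedComponentMk ⟨x, h⟩ = c := by
    intro c x
    simp [φ, SimpleGraph.ConnectedComponent.mem_supp_iff]
  have hinj : Function.Injective φ := by
    intro c d hcd
    obtain ⟨x, rfl⟩ := c.exists_rep
    have : (x : T) ∈ φ d := hcd ▸ (hφ _ _).mpr ⟨x.2, rfl⟩
    obtain ⟨h, h'⟩ := (hφ _ _).mp this
    exact h'
  refine ⟨u.toFinset, K.oddComponents.toFinset.image φ, ?_, ?_, ?_⟩
  · rw [Finset.card_image_of_injective _ hinj, ← Set.ncard_eq_toFinset_card',
      ← Set.ncard_eq_toFinset_card']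
    exact hle
  · intro S hS
    obtain ⟨c, hc, rfl⟩ := Finset.mem_image.mp hS
    rw [Set.mem_toFinset] at hc
    refine ⟨?_, ?_, ?_⟩
    · have : (φ c).card = c.supp.ncard := by
        rw [← Set.ncard_eq_toFinset_card', Set.ncard_image_of_injective _ Subtype.val_injective]
      rw [this]; exact hc
    · intro x hx
      obtain ⟨h, -⟩ := (hφ _ _).mp hx
      simpa using h
    · intro x hx y hxy hy
      obtain ⟨h, rfl⟩ := (hφ _ _).mp hx
      have hy' : y ∈ ((⊤ : H.Subgraph).deleteVerts u).verts := by simpa using hy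
      refine (hφ _ _).mpr ⟨hy', ?_⟩
      rw [SimpleGraph.ConnectedComponent.eq]
      apply SimpleGraph.Adj.reachable
      have hx' : x ∉ u := by simpa using h
      have hy'' : y ∉ u := by simpa using hy
      simp [K, hx', hy'', hxy.symm]
  · intro S hS S' hS' hne
    obtain ⟨c, -, rfl⟩ := Finset.mem_image.mp (Finset.mem_coe.mp hS)
    obtain ⟨d, -, rfl⟩ := Finset.mem_image.mp (Finset.mem_coe.mp hS')
    rw [Function.onFun, id, id, Finset.disjoint_left]
    intro x hx hx'
    obtain ⟨h, rfl⟩ := (hφ _ _).mp hx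
    obtain ⟨h', rfl⟩ := (hφ _ _).mp hx'
    exact hne rfl

/-- The total weight of the weighted pairs `(a l, b l)` with exactly one entry in `S`. -/
def cutWeight {T L : Type*} [Fintype L] [DecidableEq T] (a b : L → T) (w : L → ℕ)
    (S : Finset T) : ℕ :=
  ∑ l, if (a l ∈ S ↔ b l ∈ S) then 0 else w l

/-- A graph of even order with a weighting of total weight at most `r` at each vertex has a perfect
matching if all odd cuts avoiding the clique `Q` have weight at least `r`, except that those around
sets containing a fixed vertex `c` need only have positive weight. -/
theorem SimpleGraph.exists_perfectMatching_of_cutWeight {T L : Type*} [Fintype T] [DecidableEq T]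
    [Fintype L] (H : SimpleGraph T) (hT : Even (Fintype.card T)) (a b : L → T) (w : L → ℕ)
    (hadj : ∀ l, H.Adj (a l) (b l)) (r : ℕ)
    (hw : ∀ y, ∑ l, ((if a l = y then w l else 0) + if b l = y then w l else 0) ≤ r)
    (Q : Set T) (hQ : ∀ x ∈ Q, ∀ y ∈ Q, x ≠ y → H.Adj x y) (c : T)
    (hcut : ∀ S : Finset T, Odd S.card → (∀ x ∈ S, x ∉ Q) →
      r ≤ cutWeight a b w S ∨ (c ∈ S ∧ 0 < cutWeight a b w S)) (hr : 0 < r) :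
    ∃ M : H.Subgraph, M.IsPerfectMatching := by
  classical
  by_contra! hno
  obtain ⟨U, C, hUC, hC, hdisj⟩ := H.exists_barrier_of_no_perfectMatching hT hno
  have huniq : ∀ S ∈ C, ∀ S' ∈ C, ∀ x, x ∈ S → x ∈ S' → S = S' := by
    intro S hS S' hS' x hx hx'
    by_contra hne
    exact Finset.disjoint_left.mp (hdisj hS hS' hne) hx hx'
  have hsum : ∑ S ∈ C, cutWeight a b w S ≤ r * U.card := by
    have h1 : ∀ l, ∑ S ∈ C, (if (a l ∈ S ↔ b l ∈ S) then 0 else w l) ≤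
        (if a l ∈ U then w l else 0) + if b l ∈ U then w l else 0 := by
      intro l
      by_cases hex : ∃ S ∈ C, ¬ (a l ∈ S ↔ b l ∈ S)
      · obtain ⟨S, hS, hne⟩ := hex
        obtain ⟨-, hSU, hcl⟩ := hC S hS
        have hadj' := hadj l
        have key : ∀ S' ∈ C, S' ≠ S → (a l ∈ S' ↔ b l ∈ S') := by
          intro S' hS' hne'
          obtain ⟨-, hSU', -⟩ := hC S' hS'
          by_cases ha : a l ∈ S
          · have hb : b l ∉ S := fun h => hne (by tauto)
            have hbU : b l ∈ U := by
              by_contra hbU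
              exact hb (hcl _ ha _ hadj' hbU)
            have h1 : a l ∉ S' := fun h => hne' (huniq S' hS' S hS _ h ha)
            have h2 : b l ∉ S' := fun h => hSU' _ h hbU
            tauto
          · have hb : b l ∈ S := by tauto
            have haU : a l ∈ U := by
              by_contra haU
              exact ha (hcl _ hb _ hadj'.symm haU)
            have h1 : b l ∉ S' := fun h => hne' (huniq S' hS' S hS _ h hb)
            have h2 : a l ∉ S' := fun h => hSU' _ h haU
            tauto
        rw [Finset.sum_eq_single_of_mem S hS (fun S' hS' hne' => if_pos (key S' hS' hne')),
          if_neg hne]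
        by_cases ha : a l ∈ S
        · have hbU : b l ∈ U := by
            by_contra hbU
            have := hcl _ ha _ hadj' hbU
            tauto
          simp [hbU]
        · have hb : b l ∈ S := by tauto
          have haU : a l ∈ U := by
            by_contra haU
            exact ha (hcl _ hb _ hadj'.symm haU)
          simp [haU]
      · push Not at hex
        rw [Finset.sum_eq_zero (fun S hS => if_pos (hex S hS))]
        exact Nat.zero_le _
    calc ∑ S ∈ C, cutWeight a b w S
        = ∑ l, ∑ S ∈ C, (if (a l ∈ S ↔ b l ∈ S) then 0 else w l) := by
          unfold cutWeight; exact Finset.sum_comm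
      _ ≤ ∑ l, ((if a l ∈ U then w l else 0) + if b l ∈ U then w l else 0) :=
          Finset.sum_le_sum fun l _ => h1 l
      _ = ∑ y ∈ U, ∑ l, ((if a l = y then w l else 0) + if b l = y then w l else 0) := by
          rw [Finset.sum_comm]
          refine Finset.sum_congr rfl fun l _ => ?_
          simp [Finset.sum_add_distrib]
      _ ≤ ∑ y ∈ U, r := Finset.sum_le_sum fun y _ => hw y
      _ = r * U.card := by simp [mul_comm]
  set D := C.filter fun S => ∀ x ∈ S, x ∉ Q with hD
  have hDcard : C.card ≤ D.card + 1 := by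
    have : (C.filter fun S => ¬ ∀ x ∈ S, x ∉ Q).card ≤ 1 := by
      rw [Finset.card_le_one]
      intro S hS S' hS'
      rw [Finset.mem_filter] at hS hS'
      obtain ⟨hS, hx⟩ := hS
      obtain ⟨hS', hx'⟩ := hS'
      push Not at hx hx'
      obtain ⟨x, hxS, hxQ⟩ := hx
      obtain ⟨y, hyS, hyQ⟩ := hx'
      by_cases hxy : x = y
      · exact huniq S hS S' hS' x hxS (hxy ▸ hyS)
      · refine huniq S hS S' hS' y ?_ hyS
        exact (hC S hS).2.2 x hxS y (hQ x hxQ y hyQ hxy) ((hC S' hS').2.1 y hyS)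
    have := Finset.card_filter_add_card_filter_not (s := C) (fun S => ∀ x ∈ S, x ∉ Q)
    rw [← hD] at this
    omega
  have hDsum : ∑ S ∈ D, cutWeight a b w S ≤ r * U.card :=
    (Finset.sum_le_sum_of_subset (Finset.filter_subset _ _)).trans hsum
  have hDcut : ∀ S ∈ D, r ≤ cutWeight a b w S ∨ (c ∈ S ∧ 0 < cutWeight a b w S) := by
    intro S hS
    rw [hD, Finset.mem_filter] at hS
    exact hcut S (hC S hS.1).1 hS.2
  have hDU : U.card + 1 ≤ D.card := by omega
  by_cases hex : ∃ S ∈ D, ¬ r ≤ cutWeight a b w S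
  · obtain ⟨S, hS, hSr⟩ := hex
    obtain ⟨hcS, hpos⟩ := (hDcut S hS).resolve_left hSr
    have hrest : ∀ S' ∈ D.erase S, r ≤ cutWeight a b w S' := by
      intro S' hS'
      rw [Finset.mem_erase] at hS'
      refine (hDcut S' hS'.2).resolve_right fun h => hS'.1 ?_
      exact huniq S' (Finset.mem_of_mem_filter _ hS'.2) S (Finset.mem_of_mem_filter _ hS) c h.1 hcS
    have := Finset.card_nsmul_le_sum _ (fun S => cutWeight a b w S) _ hrest
    rw [Finset.card_erase_of_mem hS, smul_eq_mul] at this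
    have h2 := Finset.add_sum_erase D (fun S => cutWeight a b w S) hS
    have h3 : r * U.card ≤ (D.card - 1) * r := by
      rw [mul_comm]; exact Nat.mul_le_mul_right _ (by omega)
    omega
  · push Not at hex
    have := Finset.card_nsmul_le_sum _ _ _ hex
    rw [smul_eq_mul] at this
    have h3 : (U.card + 1) * r ≤ D.card * r := Nat.mul_le_mul_right _ hDU
    nlinarith

/-- The number of edges with exactly one end in `Y`, where `t e false` and `t e true` are the ends
of the edge `e`. -/
def boundaryCard {V E : Type*} [Fintype E] [DecidableEq V] (t : E → Bool → V) (Y : Finset V) : ℕ :=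
  (Finset.univ.filter fun e => ¬ (t e false ∈ Y ↔ t e true ∈ Y)).card

theorem sum_ends_mem_eq {V E : Type*} [Fintype E] [DecidableEq V]
    (t : E → Bool → V) (r : ℕ)
    (hreg : ∀ v, (Finset.univ.filter fun p : E × Bool => t p.1 p.2 = v).card = r) (Y : Finset V) :
    ∑ p : E × Bool, (if t p.1 p.2 ∈ Y then (1 : ZMod 2) else 0) = ((r * Y.card : ℕ) : ZMod 2) := by
  have h : ∀ p : E × Bool, (if t p.1 p.2 ∈ Y then (1 : ZMod 2) else 0) =
      ∑ v ∈ Y, if t p.1 p.2 = v then (1 : ZMod 2) else 0 := by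
    intro p
    simp
  rw [Finset.sum_congr rfl fun p _ => h p, Finset.sum_comm]
  simp_rw [← Finset.natCast_card_filter, hreg]
  simp [mul_comm]

theorem boundaryCard_cast_eq {V E : Type*} [Fintype E] [DecidableEq V]
    (t : E → Bool → V) (r : ℕ)
    (hreg : ∀ v, (Finset.univ.filter fun p : E × Bool => t p.1 p.2 = v).card = r) (Y : Finset V) :
    (boundaryCard t Y : ZMod 2) = ((r * Y.card : ℕ) : ZMod 2) := by
  rw [← sum_ends_mem_eq t r hreg, boundaryCard, Finset.natCast_card_filter,
    Fintype.sum_prod_type]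
  refine Finset.sum_congr rfl fun e _ => ?_
  rw [Fintype.sum_bool]
  by_cases h1 : t e false ∈ Y <;> by_cases h2 : t e true ∈ Y <;> simp [h1, h2]
  decide

section FactorGadget

variable {V E : Type*} (t : E → Bool → V) (m z : ℕ)

/-- The vertices of the gadget graph whose perfect matchings encode factors: a port for each
half-edge, `m` cores for each vertex, and `z` spare vertices. -/
abbrev GadgetVertex (V E : Type*) (m z : ℕ) := (E × Bool) ⊕ (V × Fin m) ⊕ Fin z

/-- First ends of the gadget edges: one edge joins the two ports of each edge, and each port is
joined to all cores at its vertex. -/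
def gadgetFst : E ⊕ (E × Bool) × Fin m → GadgetVertex V E m z
  | .inl e => .inl (e, false)
  | .inr (p, _) => .inl p

/-- Second ends of the gadget edges. -/
def gadgetSnd : E ⊕ (E × Bool) × Fin m → GadgetVertex V E m z
  | .inl e => .inl (e, true)
  | .inr (p, i) => .inr (.inl (t p.1 p.2, i))

/-- The weights of the gadget edges. -/
def gadgetWeight (k : ℕ) : E ⊕ (E × Bool) × Fin m → ℕ
  | .inl _ => k
  | .inr _ => 1

/-- The gadget vertices that do not belong to the vertex set `W`. -/
def gadgetOutside (W : Finset V) : Set (GadgetVertex V E m z)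
  | .inl p => t p.1 p.2 ∉ W
  | .inr (.inl q) => q.1 ∉ W
  | .inr (.inr _) => True

/-- The gadget graph: the gadget edges together with a clique on the vertices outside `W`. -/
def gadgetGraph (W : Finset V) : SimpleGraph (GadgetVertex V E m z) :=
  SimpleGraph.fromRel fun x y => (∃ l, gadgetFst m z l = x ∧ gadgetSnd t m z l = y) ∨
    (x ∈ gadgetOutside t m z W ∧ y ∈ gadgetOutside t m z W)

variable {t m z}

theorem gadgetGraph_adj {W : Finset V} {x y : GadgetVertex V E m z}
    (hx : x ∉ gadgetOutside t m z W) (h : (gadgetGraph t m z W).Adj x y) :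
    (∃ l, gadgetFst m z l = x ∧ gadgetSnd t m z l = y) ∨
      ∃ l, gadgetFst m z l = y ∧ gadgetSnd t m z l = x := by
  rw [gadgetGraph, SimpleGraph.fromRel_adj] at h
  obtain ⟨-, (h | h) | (h | h)⟩ := h
  · exact Or.inl h
  · exact absurd h.1 hx
  · exact Or.inr h
  · exact absurd h.2 hx

variable [DecidableEq V]

/-- In a perfect matching of the gadget graph, the cores at a vertex `v ∈ W` absorb exactly `m` of
its ports. -/
theorem gadget_card_unmatched [Fintype E] {W : Finset V} {M : (gadgetGraph t m z W).Subgraph}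
    (hM : M.IsPerfectMatching) {v : V} (hv : v ∈ W) [DecidablePred fun e : E =>
      M.Adj (.inl (e, false)) (.inl (e, true))] :
    (Finset.univ.filter fun p : E × Bool => t p.1 p.2 = v ∧
      ¬ M.Adj (.inl (p.1, false)) (.inl (p.1, true))).card = m := by
  rw [SimpleGraph.Subgraph.isPerfectMatching_iff] at hM
  have huniq : ∀ {x y y'}, M.Adj x y → M.Adj x y' → y = y' := fun h h' => (hM _).unique h h'
  have hcore : ∀ i : Fin m, ∃ p : E × Bool, t p.1 p.2 = v ∧
      M.Adj (.inr (.inl (v, i))) (.inl p) := by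
    intro i
    obtain ⟨y, hy, -⟩ := hM (.inr (.inl (v, i)))
    have hc : (.inr (.inl (v, i)) : GadgetVertex V E m z) ∉ gadgetOutside t m z W :=
      fun h => (show v ∉ W from h) hv
    rcases gadgetGraph_adj hc hy.adj_sub with ⟨l, h1, h2⟩ | ⟨l, h1, h2⟩
    · rcases l with e | ⟨p, j⟩ <;> simp [gadgetFst] at h1
    · rcases l with e | ⟨p, j⟩
      · simp [gadgetSnd] at h2
      · simp only [gadgetSnd, Sum.inr.injEq, Sum.inl.injEq, Prod.mk.injEq] at h2
        subst h1
        exact ⟨p, h2.1, hy⟩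
  choose g hg hgM using hcore
  refine Eq.trans
    (Finset.card_bij (s := (Finset.univ : Finset (Fin m))) (fun i _ => g i) ?_ ?_ ?_).symm (by simp)
  · intro i _
    simp only [Finset.mem_filter, Finset.mem_univ, true_and]
    refine ⟨hg i, fun h => ?_⟩
    have h1 := (hgM i).symm
    rcases hgi : g i with ⟨e, b⟩
    rw [hgi] at h h1
    cases b
    · cases huniq h h1
    · cases huniq h.symm h1
  · intro i _ j _ hij
    have := huniq (hgM i).symm (hij ▸ (hgM j).symm)
    simpa using this
  · intro p hp
    simp only [Finset.mem_filter, Finset.mem_univ, true_and] at hp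
    obtain ⟨hpv, hpM⟩ := hp
    obtain ⟨y, hy, -⟩ := hM (.inl p)
    have hp' : (.inl p : GadgetVertex V E m z) ∉ gadgetOutside t m z W :=
      fun h => (show t p.1 p.2 ∉ W from h) (hpv ▸ hv)
    rcases gadgetGraph_adj hp' hy.adj_sub with ⟨l, h1, h2⟩ | ⟨l, h1, h2⟩
    · rcases l with e | ⟨p', j⟩
      · refine absurd ?_ hpM
        simp only [gadgetFst, Sum.inl.injEq] at h1
        subst h1
        subst h2
        exact hy
      · simp only [gadgetFst, Sum.inl.injEq] at h1
        subst h1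
        refine ⟨j, Finset.mem_univ _, ?_⟩
        simp only [gadgetSnd, hpv] at h2
        exact Sum.inl_injective (huniq (hgM j) (h2 ▸ hy).symm)
    · rcases l with e | ⟨p', j⟩
      · refine absurd ?_ hpM
        simp only [gadgetSnd, Sum.inl.injEq] at h2
        subst h2
        subst h1
        exact hy.symm
      · simp [gadgetSnd] at h2

variable [DecidableEq E]

theorem gadget_cutWeight [Fintype E] (k : ℕ) (S : Finset (GadgetVertex V E m z)) :
    cutWeight (gadgetFst m z) (gadgetSnd t m z) (gadgetWeight m k) S =
      ∑ e : E, (if (.inl (e, false) ∈ S ↔ .inl (e, true) ∈ S) then 0 else k) +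
      ∑ p : E × Bool, ∑ i : Fin m,
        if (.inl p ∈ S ↔ .inr (.inl (t p.1 p.2, i)) ∈ S) then 0 else 1 := by
  rw [cutWeight, Fintype.sum_sum_type, Fintype.sum_prod_type (γ := ℕ)]
  rfl

theorem gadget_weight_le [Fintype E] {r k : ℕ}
    (hreg : ∀ v, (Finset.univ.filter fun p : E × Bool => t p.1 p.2 = v).card = r) (hk : k + m = r)
    (y : GadgetVertex V E m z) :
    ∑ l, ((if gadgetFst m z l = y then gadgetWeight m k l else 0) +
      if gadgetSnd t m z l = y then gadgetWeight m k l else 0) ≤ r := by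
  rw [Fintype.sum_sum_type, Fintype.sum_prod_type]
  rcases y with ⟨e, b⟩ | ⟨v, i⟩ | i
  · cases b <;> simp [gadgetFst, gadgetSnd, gadgetWeight, hk, Finset.sum_ite_eq']
  · simp only [gadgetFst, gadgetSnd, gadgetWeight]
    simp only [reduceCtorEq, if_false, Sum.inr.injEq, Sum.inl.injEq, Prod.mk.injEq, add_zero,
      Finset.sum_const_zero, zero_add]
    rw [← hreg v, Finset.card_filter]
    refine Finset.sum_le_sum fun p _ => ?_
    by_cases hp : t p.1 p.2 = v <;> simp [hp]
  · simp [gadgetFst, gadgetSnd]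

theorem gadget_oddCut [Fintype V] [Fintype E] {r k : ℕ}
    (hreg : ∀ v, (Finset.univ.filter fun p : E × Bool => t p.1 p.2 = v).card = r) (hk : k + m = r)
    (hk0 : 0 < k) (hm0 : 0 < m)
    (hpar : Even k ∧ r ≤ 3 * m ∨ Odd k ∧ Odd r ∧ r ≤ 3 * k) {W : Finset V}
    (hW : ∀ Y ⊆ W, Y ≠ W → boundaryCard t Y ≠ 1) {c : V} (hc : c ∈ W)
    (S : Finset (GadgetVertex V E m z)) (hS : Odd S.card)
    (hSW : ∀ x ∈ S, x ∉ gadgetOutside t m z W) :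
    r ≤ cutWeight (gadgetFst m z) (gadgetSnd t m z) (gadgetWeight m k) S ∨
      (.inr (.inl (c, ⟨0, hm0⟩)) ∈ S ∧
        0 < cutWeight (gadgetFst m z) (gadgetSnd t m z) (gadgetWeight m k) S) := by
  classical
  rw [gadget_cutWeight]
  by_cases hpart : ∃ v i i', (.inr (.inl (v, i)) : GadgetVertex V E m z) ∈ S ∧
      (.inr (.inl (v, i')) : GadgetVertex V E m z) ∉ S
  · left
    obtain ⟨v, i, i', hi, hi'⟩ := hpart
    refine le_trans ?_ (Nat.le_add_left _ _)
    rw [← hreg v, Finset.card_filter]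
    refine Finset.sum_le_sum fun p _ => ?_
    split_ifs with hp
    · by_cases hpS : .inl p ∈ S
      · refine le_trans ?_ (Finset.single_le_sum (fun _ _ => Nat.zero_le _) (Finset.mem_univ i'))
        simp [hp, hpS, hi']
      · refine le_trans ?_ (Finset.single_le_sum (fun _ _ => Nat.zero_le _) (Finset.mem_univ i))
        simp [hp, hpS, hi]
    · exact Nat.zero_le _
  push Not at hpart
  set Y : Finset V := Finset.univ.filter fun v =>
    (.inr (.inl (v, ⟨0, hm0⟩)) : GadgetVertex V E m z) ∈ S with hY
  have hYmem : ∀ v i, (.inr (.inl (v, i)) : GadgetVertex V E m z) ∈ S ↔ v ∈ Y := by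
    intro v i
    simp only [hY, Finset.mem_filter, Finset.mem_univ, true_and]
    exact ⟨fun h => hpart v _ _ h, fun h => hpart v _ _ h⟩
  have hYW : Y ⊆ W := by
    intro v hv
    by_contra hvW
    exact hSW _ ((hYmem v ⟨0, hm0⟩).mpr hv) hvW
  rw [hYmem]
  clear_value Y
  obtain ⟨s, hs⟩ : ∃ s : E → Bool → Prop,
      ∀ e b, (.inl (e, b) : GadgetVertex V E m z) ∈ S ↔ s e b := ⟨_, fun _ _ => Iff.rfl⟩
  have hcard : (S.card : ZMod 2) =
      ∑ p : E × Bool, (if s p.1 p.2 then 1 else 0) + ((m * Y.card : ℕ) : ZMod 2) := by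
    have h1 : S.card = (Finset.univ.filter fun x => x ∈ S).card := by simp
    rw [h1, Finset.natCast_card_filter, Fintype.sum_sum_type, Fintype.sum_sum_type,
      Fintype.sum_prod_type (γ := ZMod 2) (α₁ := V)]
    have h2 : ∀ i : Fin z, (.inr (.inr i) : GadgetVertex V E m z) ∉ S := fun i h => hSW _ h trivial
    simp only [hYmem, h2, if_false, Finset.sum_const_zero, add_zero, hs, Finset.sum_const,
      Finset.card_univ, Fintype.card_fin]
    rw [← Finset.smul_sum]
    simp
  have hcost : ∑ e : E, (if (.inl (e, false) ∈ S ↔ .inl (e, true) ∈ S) then 0 else k) +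
      ∑ p : E × Bool, ∑ i : Fin m,
        (if (.inl p ∈ S ↔ .inr (.inl (t p.1 p.2, i)) ∈ S) then 0 else 1) =
      ∑ e : E, ((if (s e false ↔ s e true) then 0 else k) +
        ((if (s e false ↔ t e false ∈ Y) then 0 else m) +
          if (s e true ↔ t e true ∈ Y) then 0 else m)) := by
    rw [Fintype.sum_prod_type, ← Finset.sum_add_distrib]
    refine Finset.sum_congr rfl fun e _ => ?_
    simp only [hYmem, hs, Fintype.sum_bool, Finset.sum_const, Finset.card_univ, Fintype.card_fin,
      smul_eq_mul, mul_ite, mul_zero, mul_one, add_comm]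
  rw [hcost]
  by_cases hinner : ∃ e, (t e false ∈ Y ↔ t e true ∈ Y) ∧ ¬ (s e false ↔ s e true)
  · left
    obtain ⟨e, he, hse⟩ := hinner
    refine le_trans ?_ (Finset.single_le_sum (fun _ _ => Nat.zero_le _) (Finset.mem_univ e))
    by_cases h1 : t e false ∈ Y <;> by_cases h2 : s e false <;>
      by_cases h3 : t e true ∈ Y <;> by_cases h4 : s e true <;>
      simp [h1, h2, h3, h4] at he hse ⊢ <;> omega
  push Not at hinner
  set J := Finset.univ.filter fun e : E => ¬ (t e false ∈ Y ↔ t e true ∈ Y) ∧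
    (s e false ↔ s e true) with hJ
  set J' := Finset.univ.filter fun e : E => ¬ (t e false ∈ Y ↔ t e true ∈ Y) ∧
    ¬ (s e false ↔ s e true) with hJ'
  have hδ : boundaryCard t Y = J.card + J'.card := by
    rw [boundaryCard, hJ, hJ', ← Finset.filter_filter, ← Finset.filter_filter,
      Finset.card_filter_add_card_filter_not]
  have hbound : k * J'.card + m * J.card ≤
      ∑ e : E, ((if (s e false ↔ s e true) then 0 else k) +
        ((if (s e false ↔ t e false ∈ Y) then 0 else m) +
          if (s e true ↔ t e true ∈ Y) then 0 else m)) := by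
    rw [hJ, hJ', Finset.card_filter, Finset.card_filter, Finset.mul_sum, Finset.mul_sum,
      ← Finset.sum_add_distrib]
    refine Finset.sum_le_sum fun e _ => ?_
    by_cases h1 : t e false ∈ Y <;> by_cases h2 : s e false <;>
      by_cases h3 : t e true ∈ Y <;> by_cases h4 : s e true <;> simp [h1, h2, h3, h4]
  refine Or.imp (le_trans · hbound) (And.imp_right (lt_of_lt_of_le · hbound)) ?_
  have hpY := boundaryCard_cast_eq t r hreg Y
  have hpS : (S.card : ZMod 2) = (((m + r) * Y.card + J.card : ℕ) : ZMod 2) := by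
    rw [hcard, add_mul, add_assoc, Nat.cast_add, add_comm, add_right_inj, Nat.cast_add,
      ← sum_ends_mem_eq t r hreg, hJ, Finset.natCast_card_filter, Fintype.sum_prod_type,
      Fintype.sum_prod_type, ← Finset.sum_add_distrib]
    refine Finset.sum_congr rfl fun e _ => ?_
    have := hinner e
    simp only [Fintype.sum_bool]
    by_cases h1 : t e false ∈ Y <;> by_cases h2 : s e false <;>
      by_cases h3 : t e true ∈ Y <;> by_cases h4 : s e true <;> simp [h1, h2, h3, h4] at this ⊢
    all_goals decide
  rw [ZMod.natCast_eq_natCast_iff, Nat.ModEq] at hpY hpS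
  have hne : Y = W ∨ J.card + J'.card ≠ 1 := by
    by_cases h : Y = W
    · exact Or.inl h
    · exact Or.inr (hδ ▸ hW Y hYW h)
  rw [hδ] at hpY
  have hS' : (((m + r) * Y.card + J.card) % 2) = 1 := hpS ▸ Nat.odd_iff.mp hS
  clear_value J J'
  have hodd : Even k ∧ r ≤ 3 * m ∧ J.card % 2 = 1 ∨ r ≤ 3 * k ∧ J'.card % 2 = 1 := by
    rcases hpar with ⟨hk2, h3⟩ | ⟨hk2, hr2, h3⟩
    · refine Or.inl ⟨hk2, h3, ?_⟩
      have : Even ((m + r) * Y.card) := by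
        rw [← hk]
        exact Even.mul_right (by grind) _
      grind
    · refine Or.inr ⟨h3, ?_⟩
      have : Even (m * Y.card) := Even.mul_right (by grind) _
      rw [add_mul] at hS'
      grind
  have hpos : J.card + J'.card ≠ 0 := by omega
  rcases hne with rfl | hne
  · refine Or.inr ⟨hc, ?_⟩
    by_cases h : J.card = 0
    · have := Nat.mul_pos hk0 (Nat.pos_of_ne_zero (by omega : J'.card ≠ 0))
      omega
    · have := Nat.mul_pos hm0 (Nat.pos_of_ne_zero h)
      omega
  left
  have mul_le : ∀ {a b c : ℕ}, b ≤ c → a * b ≤ a * c := fun h => Nat.mul_le_mul_left _ h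
  rcases hodd with ⟨-, h3, hJ1⟩ | ⟨h3, hJ1⟩
  · by_cases h : J'.card = 0
    · have := mul_le (a := m) (by omega : 3 ≤ J.card)
      omega
    · have h4 := mul_le (a := m) (by omega : 1 ≤ J.card)
      have h5 := mul_le (a := k) (by omega : 1 ≤ J'.card)
      omega
  · by_cases h : J.card = 0
    · have := mul_le (a := k) (by omega : 3 ≤ J'.card)
      omega
    · have h4 := mul_le (a := m) (by omega : 1 ≤ J.card)
      have h5 := mul_le (a := k) (by omega : 1 ≤ J'.card)
      omega

end FactorGadget

/-- Let every vertex have degree `r`, and let `W` be a set of vertices none of whose proper subsets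
has a boundary of exactly one edge. Then some set of edges has degree `k` at all vertices of `W`. -/
theorem exists_factor_on {V E : Type*} [Fintype V] [Fintype E] [DecidableEq V] [DecidableEq E]
    (t : E → Bool → V) {r k : ℕ}
    (hreg : ∀ v, (Finset.univ.filter fun p : E × Bool => t p.1 p.2 = v).card = r)
    (hk0 : 0 < k) (hkr : k < r)
    (hpar : Even k ∧ r ≤ 3 * (r - k) ∨ Odd k ∧ Odd r ∧ r ≤ 3 * k) {W : Finset V}
    (hW : ∀ Y ⊆ W, Y ≠ W → boundaryCard t Y ≠ 1) :
    ∃ P : Finset E, ∀ v ∈ W,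
      (Finset.univ.filter fun p : E × Bool => t p.1 p.2 = v ∧ p.1 ∈ P).card = k := by
  classical
  rcases W.eq_empty_or_nonempty with rfl | ⟨c, hc⟩
  · exact ⟨∅, by simp⟩
  obtain ⟨m, hm⟩ : ∃ m, m = r - k := ⟨_, rfl⟩
  obtain ⟨z, hz⟩ : ∃ z, Even (Fintype.card (GadgetVertex V E m z)) := by
    rcases Nat.even_or_odd (Fintype.card (E × Bool) + Fintype.card (V × Fin m)) with h | h
    · exact ⟨0, by simpa using h⟩
    · refine ⟨1, ?_⟩
      rw [Fintype.card_sum, Fintype.card_sum, Fintype.card_fin, ← add_assoc]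
      exact h.add_one
  have hkm : k + m = r := by omega
  have hm0 : 0 < m := by omega
  rw [← hm] at hpar
  obtain ⟨M, hM⟩ := (gadgetGraph t m z W).exists_perfectMatching_of_cutWeight hz
    (gadgetFst m z) (gadgetSnd t m z) (gadgetWeight m k)
    (fun l => by
      refine (SimpleGraph.fromRel_adj _ _ _).mpr ⟨?_, Or.inl (Or.inl ⟨l, rfl, rfl⟩)⟩
      rcases l with e | ⟨p, i⟩ <;> simp [gadgetFst, gadgetSnd])
    r (gadget_weight_le hreg hkm) (gadgetOutside t m z W)
    (fun x hx y hy hxy => (SimpleGraph.fromRel_adj _ _ _).mpr ⟨hxy, Or.inl (Or.inr ⟨hx, hy⟩)⟩)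
    _ (gadget_oddCut hreg hkm hk0 hm0 hpar hW hc) (by omega)
  refine ⟨Finset.univ.filter fun e => M.Adj (.inl (e, false)) (.inl (e, true)), fun v hv => ?_⟩
  have h1 := gadget_card_unmatched hM hv
  have h2 := Finset.card_filter_add_card_filter_not
    (s := Finset.univ.filter fun p : E × Bool => t p.1 p.2 = v)
    (fun p => M.Adj (.inl (p.1, false)) (.inl (p.1, true)))
  rw [Finset.filter_filter, Finset.filter_filter, hreg, h1] at h2
  simp only [Finset.mem_filter, Finset.mem_univ, true_and]
  omega

theorem exists_matching_of_regular_darts {V ι : Type*} [DecidableEq V] [DecidableEq ι]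
    (src tgt : ι → V) (A : Finset V) (D : Finset ι) {d : ℕ} (hd : 0 < d)
    (hsrc : ∀ x ∈ D, src x ∈ A) (htgt : ∀ x ∈ D, tgt x ∈ A)
    (hout : ∀ v ∈ A, (D.filter fun x => src x = v).card = d)
    (hin : ∀ v ∈ A, (D.filter fun x => tgt x = v).card = d) :
    ∃ R ⊆ D, (∀ v ∈ A, (R.filter fun x => src x = v).card = 1) ∧
      ∀ v ∈ A, (R.filter fun x => tgt x = v).card = 1 := by
  have hall := (Finset.all_card_le_biUnion_card_iff_exists_injective
    (fun v : A => (D.filter fun x => src x = v).image tgt)).mp ?_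
  · obtain ⟨f, hf, hfD⟩ := hall
    simp only [Finset.mem_image, Finset.mem_filter] at hfD
    choose g hg hgf using hfD
    have hfA : ∀ v, f v ∈ A := fun v => hgf v ▸ htgt _ (hg v).1
    have hsurj : ∀ v ∈ A, ∃ u : A, f u = v := by
      intro v hv
      have : Function.Surjective fun u : A => (⟨f u, hfA u⟩ : A) :=
        Finite.surjective_of_injective fun a b hab => hf (Subtype.ext_iff.mp hab)
      obtain ⟨u, hu⟩ := this ⟨v, hv⟩
      exact ⟨u, Subtype.ext_iff.mp hu⟩
    refine ⟨Finset.univ.image g, ?_, fun v hv => ?_, fun v hv => ?_⟩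
    · intro x hx
      obtain ⟨v, -, rfl⟩ := Finset.mem_image.mp hx
      exact (hg v).1
    · rw [Finset.card_eq_one]
      refine ⟨g ⟨v, hv⟩, ?_⟩
      ext x
      simp only [Finset.mem_filter, Finset.mem_image, Finset.mem_univ, true_and,
        Finset.mem_singleton]
      constructor
      · rintro ⟨⟨u, rfl⟩, hu⟩
        congr 1
        exact Subtype.ext ((hg u).2.symm.trans hu)
      · rintro rfl
        exact ⟨⟨_, rfl⟩, (hg _).2⟩
    · obtain ⟨u, rfl⟩ := hsurj v hv
      rw [Finset.card_eq_one]
      refine ⟨g u, ?_⟩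
      ext x
      simp only [Finset.mem_filter, Finset.mem_image, Finset.mem_univ, true_and,
        Finset.mem_singleton]
      constructor
      · rintro ⟨⟨w, rfl⟩, hw⟩
        rw [hgf] at hw
        rw [hf hw]
      · rintro rfl
        exact ⟨⟨_, rfl⟩, hgf _⟩
  · intro S
    set T := S.biUnion fun v : A => (D.filter fun x => src x = v).image tgt with hT
    have hTA : T ⊆ A := by
      intro v hv
      simp only [hT, Finset.mem_biUnion, Finset.mem_image, Finset.mem_filter] at hv
      obtain ⟨-, -, x, ⟨hx, -⟩, rfl⟩ := hv
      exact htgt x hx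
    have h1 : (D.filter fun x => ∃ h : src x ∈ A, (⟨_, h⟩ : A) ∈ S).card = S.card * d := by
      rw [Finset.card_eq_sum_card_fiberwise (f := src) (t := S.map ⟨_, Subtype.val_injective⟩),
        Finset.sum_map, ← smul_eq_mul, ← Finset.sum_const]
      · refine Finset.sum_congr rfl fun v hv => ?_
        rw [← hout v v.2, Finset.filter_filter]
        congr 1
        ext x
        simp only [Finset.mem_filter, Function.Embedding.coeFn_mk]
        constructor
        · rintro ⟨h, -, h'⟩
          exact ⟨h, h'⟩
        · rintro ⟨h, h'⟩
          refine ⟨h, ⟨hsrc x h, ?_⟩, h'⟩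
          simpa only [h'] using hv
      · intro x hx
        simp only [Finset.coe_filter, Set.mem_ofPred_eq] at hx
        obtain ⟨-, h, h'⟩ := hx
        simp [h, h']
    have h2 : (D.filter fun x => tgt x ∈ T).card = T.card * d := by
      rw [Finset.card_eq_sum_card_fiberwise (f := tgt) (t := T), ← smul_eq_mul, ← Finset.sum_const]
      · refine Finset.sum_congr rfl fun v hv => ?_
        rw [← hin v (hTA hv), Finset.filter_filter]
        congr 1
        ext x
        simp only [Finset.mem_filter]
        constructor
        · rintro ⟨h, -, h'⟩
          exact ⟨h, h'⟩
        · rintro ⟨h, rfl⟩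
          exact ⟨h, hv, rfl⟩
      · intro x hx
        simpa using (Finset.mem_filter.mp hx).2
    have h3 : S.card * d ≤ T.card * d := by
      rw [← h1, ← h2]
      refine Finset.card_le_card fun x hx => ?_
      simp only [Finset.mem_filter] at hx ⊢
      obtain ⟨hx, h, h'⟩ := hx
      refine ⟨hx, ?_⟩
      simp only [hT, Finset.mem_biUnion, Finset.mem_image, Finset.mem_filter]
      exact ⟨_, h', x, ⟨hx, rfl⟩, rfl⟩
    exact Nat.le_of_mul_le_mul_right h3 hd

/-- A `d`-regular digraph contains an `s`-regular spanning subdigraph for every `s ≤ d`. -/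
theorem exists_regular_darts {V ι : Type*} [DecidableEq V] [DecidableEq ι]
    (src tgt : ι → V) (A : Finset V) (s : ℕ) : ∀ (D : Finset ι) {d : ℕ} (_ : s ≤ d)
    (_ : ∀ x ∈ D, src x ∈ A) (_ : ∀ x ∈ D, tgt x ∈ A)
    (_ : ∀ v ∈ A, (D.filter fun x => src x = v).card = d)
    (_ : ∀ v ∈ A, (D.filter fun x => tgt x = v).card = d),
    ∃ R ⊆ D, (∀ v ∈ A, (R.filter fun x => src x = v).card = s) ∧
      ∀ v ∈ A, (R.filter fun x => tgt x = v).card = s := by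
  induction s with
  | zero => exact fun D d _ _ _ _ _ => ⟨∅, by simp⟩
  | succ s ih =>
    intro D d hs hsrc htgt hout hin
    obtain ⟨R, hR, hRout, hRin⟩ :=
      exists_matching_of_regular_darts src tgt A D (by omega) hsrc htgt hout hin
    have hcard : ∀ q : ι → Prop, [DecidablePred q] →
        ((D \ R).filter q).card = (D.filter q).card - (R.filter q).card := by
      intro q _
      rw [← Finset.card_sdiff_of_subset (Finset.filter_subset_filter q hR)]
      congr 1
      ext x
      simp only [Finset.mem_filter, Finset.mem_sdiff]
      tauto
    obtain ⟨R', hR', hR'out, hR'in⟩ := ih (D \ R) (d := d - 1) (by omega)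
      (fun x hx => hsrc x (Finset.mem_sdiff.mp hx).1)
      (fun x hx => htgt x (Finset.mem_sdiff.mp hx).1)
      (fun v hv => by rw [hcard, hout v hv, hRout v hv])
      (fun v hv => by rw [hcard, hin v hv, hRin v hv])
    have hdisj : Disjoint R' R :=
      Finset.disjoint_left.mpr fun x hx => (Finset.mem_sdiff.mp (hR' hx)).2
    have hunion : ∀ q : ι → Prop, [DecidablePred q] →
        ((R' ∪ R).filter q).card = (R'.filter q).card + (R.filter q).card := by
      intro q _
      rw [Finset.filter_union,
        Finset.card_union_of_disjoint (Finset.disjoint_filter_filter hdisj)]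
    exact ⟨R' ∪ R, Finset.union_subset (hR'.trans Finset.sdiff_subset) hR,
      fun v hv => by rw [hunion, hR'out v hv, hRout v hv],
      fun v hv => by rw [hunion, hR'in v hv, hRin v hv]⟩

theorem sum_ports_flip {E M : Type*} [Fintype E] [AddCommMonoid M] (g : E × Bool → M) :
    ∑ p : E × Bool, g (p.1, !p.2) = ∑ p : E × Bool, g p := by
  rw [Fintype.sum_prod_type, Fintype.sum_prod_type]
  simp [add_comm]

/-- If the edges in `P` have degree `κ` on `A` and do not leave `A`, then they carry weights in
`{0, 1, 2}` with sum `2 * s` at each vertex of `A`, for every `s ≤ κ`. -/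
theorem exists_weight_of_factor {V E : Type*} [Fintype E] [DecidableEq V] [DecidableEq E]
    (t : E → Bool → V) (P : Finset E) (A : Finset V) {κ s : ℕ} (hs : s ≤ κ)
    (hPA : ∀ e ∈ P, (t e false ∈ A ↔ t e true ∈ A))
    (hκ : ∀ v ∈ A, (Finset.univ.filter fun p : E × Bool => t p.1 p.2 = v ∧ p.1 ∈ P).card = κ) :
    ∃ n : E → ℕ, (∀ e, n e ≤ 2) ∧ ∀ v ∈ A,
      ∑ p ∈ Finset.univ.filter (fun p : E × Bool => t p.1 p.2 = v ∧ p.1 ∈ P), n p.1 = 2 * s := by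
  have hflip : ∀ e ∈ P, ∀ b, t e b ∈ A → t e (!b) ∈ A := by
    intro e he b
    have := hPA e he
    cases b
    · exact this.mp
    · exact this.mpr
  set D := Finset.univ.filter fun p : E × Bool => p.1 ∈ P ∧ t p.1 p.2 ∈ A with hD
  have hout : ∀ v ∈ A, (D.filter fun p => t p.1 p.2 = v).card = κ := by
    intro v hv
    rw [← hκ v hv, hD, Finset.filter_filter]
    congr 1
    ext p
    simp only [Finset.mem_filter, Finset.mem_univ, true_and]
    constructor
    · rintro ⟨⟨h, -⟩, h'⟩
      exact ⟨h', h⟩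
    · rintro ⟨rfl, h⟩
      exact ⟨⟨h, hv⟩, rfl⟩
  have hin : ∀ v ∈ A, (D.filter fun p => t p.1 (!p.2) = v).card = κ := by
    intro v hv
    rw [← hout v hv, hD, Finset.filter_filter, Finset.filter_filter, Finset.card_filter,
      Finset.card_filter, ← sum_ports_flip]
    refine Finset.sum_congr rfl fun p _ => ?_
    simp only [Bool.not_not]
    congr 2
    refine propext (and_congr_right fun h => ?_)
    exact ⟨fun h' => by simpa using hflip _ h _ h', hflip _ h _⟩
  obtain ⟨R, hRD, hRout, hRin⟩ := exists_regular_darts (fun p : E × Bool => t p.1 p.2)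
    (fun p => t p.1 (!p.2)) A s D hs (fun p hp => (Finset.mem_filter.mp hp).2.2)
    (fun p hp => hflip _ (Finset.mem_filter.mp hp).2.1 _ (Finset.mem_filter.mp hp).2.2) hout hin
  have hRP : ∀ p ∈ R, p.1 ∈ P := fun p hp => (Finset.mem_filter.mp (hRD hp)).2.1
  refine ⟨fun e => (if (e, false) ∈ R then 1 else 0) + if (e, true) ∈ R then 1 else 0,
    fun e => by dsimp only; split_ifs <;> omega, fun v hv => ?_⟩
  have h1 := hRout v hv
  have h2 := hRin v hv
  have hR : ∀ q : E × Bool → Prop, [DecidablePred q] →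
      (R.filter q).card = ∑ p : E × Bool, if q p ∧ p ∈ R then 1 else 0 := by
    intro q _
    rw [← Finset.card_filter]
    congr 1
    ext p
    simp [and_comm]
  rw [hR] at h1 h2
  rw [← sum_ports_flip] at h2
  rw [two_mul, Finset.sum_filter]
  nth_rw 1 [← h1]
  nth_rw 1 [← h2]
  rw [← Finset.sum_add_distrib]
  refine Finset.sum_congr rfl fun ⟨e, b⟩ _ => ?_
  have h3 := hRP (e, false)
  have h4 := hRP (e, true)
  by_cases he : e ∈ P
  · by_cases hv : t e b = v
    · cases b <;> simp [he, hv, add_comm]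
    · simp [hv]
  · have h5 : ∀ b, (e, b) ∉ R := fun b h => he (hRP _ h)
    simp [he, h5]

/-- A graph of degree `r` has a zero-sum `5`-flow as soon as its vertex set splits into two parts
such that some set of edges, none of which joins the two parts, has a suitable degree `κ` on one
part and a suitable even degree `2 * h` on the other. -/
theorem exists_flow_of_factor {V E : Type*} [Fintype V] [Fintype E] [DecidableEq V] [DecidableEq E]
    (t : E → Bool → V) {r : ℕ}
    (hreg : ∀ v, (Finset.univ.filter fun p : E × Bool => t p.1 p.2 = v).card = r)
    (P : Finset E) (A : Finset V) {κ h : ℕ}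
    (hPA : ∀ e ∈ P, (t e false ∈ A ↔ t e true ∈ A))
    (hA : ∀ v ∈ A, (Finset.univ.filter fun p : E × Bool => t p.1 p.2 = v ∧ p.1 ∈ P).card = κ)
    (hB : ∀ v ∉ A, (Finset.univ.filter fun p : E × Bool => t p.1 p.2 = v ∧ p.1 ∈ P).card = 2 * h)
    (hκ : 2 * κ ≤ r) (hκ' : r ≤ 3 * κ) (hh : 3 * h ≤ r) (hh' : r ≤ 5 * h) :
    ∃ f : E → ℤ, (∀ e, f e ≠ 0 ∧ |f e| ≤ 4) ∧
      ∀ v, ∑ p : E × Bool, (if t p.1 p.2 = v then f p.1 else 0) = 0 := by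
  obtain ⟨n, hn, hnA⟩ := exists_weight_of_factor t P A (s := r - 2 * κ) (by omega) hPA hA
  obtain ⟨n', hn', hnB⟩ := exists_weight_of_factor t P Aᶜ (s := r - 3 * h) (κ := 2 * h) (by omega)
    (fun e he => by simpa [not_iff_not] using hPA e he) (fun v hv => hB v (by simpa using hv))
  refine ⟨fun e => if e ∈ P then (if t e false ∈ A then -(2 + n e : ℤ) else -(1 + n' e : ℤ)) else 2,
    fun e => ?_, fun v => ?_⟩
  · have h1 := hn e
    have h2 := hn' e
    dsimp only
    split_ifs
    · rw [abs_neg, abs_of_nonneg] <;> omega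
    · rw [abs_neg, abs_of_nonneg] <;> omega
    · simp
  have hside : ∀ p : E × Bool, p.1 ∈ P → (t p.1 false ∈ A ↔ t p.1 p.2 ∈ A) := by
    rintro ⟨e, b⟩ he
    cases b
    · rfl
    · exact hPA e he
  have key : ∀ (a : ℤ) (d : ℕ) (w : E → ℕ),
      (Finset.univ.filter fun p : E × Bool => t p.1 p.2 = v ∧ p.1 ∈ P).card = d →
      ∑ p : E × Bool, (if t p.1 p.2 = v then (if p.1 ∈ P then -(a + w p.1) else 2) else (0 : ℤ)) =
        2 * r - (a + 2) * d - (∑ p ∈ Finset.univ.filter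
          (fun p : E × Bool => t p.1 p.2 = v ∧ p.1 ∈ P), w p.1 : ℕ) := by
    intro a d w hd
    rw [← hd, ← hreg v, Finset.card_filter, Finset.card_filter, Finset.sum_filter]
    push_cast
    rw [Finset.mul_sum, Finset.mul_sum, ← Finset.sum_sub_distrib, ← Finset.sum_sub_distrib]
    refine Finset.sum_congr rfl fun p _ => ?_
    by_cases h1 : t p.1 p.2 = v <;> by_cases h2 : p.1 ∈ P <;> simp [h1, h2]
    ring
  by_cases hv : v ∈ A
  · have h1 := key 2 κ n (hA v hv)
    rw [hnA v hv] at h1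
    refine Eq.trans (Finset.sum_congr rfl fun p _ => ?_) (h1.trans ?_)
    · by_cases hp : t p.1 p.2 = v
      · by_cases hpP : p.1 ∈ P
        · simp [hp, hpP, (hside p hpP).mpr (hp ▸ hv)]
        · simp [hp, hpP]
      · simp [hp]
    · push_cast [hκ]
      ring
  · have h1 := key 1 (2 * h) n' (hB v hv)
    rw [hnB v (by simpa using hv)] at h1
    refine Eq.trans (Finset.sum_congr rfl fun p _ => ?_) (h1.trans ?_)
    · by_cases hp : t p.1 p.2 = v
      · by_cases hpP : p.1 ∈ P
        · simp [hp, hpP, (hside p hpP).not.mpr (hp ▸ hv)]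
        · simp [hp, hpP]
      · simp [hp]
    · push_cast [hh]
      ring

section Uncrossing

variable {V E : Type*} [Fintype E] [DecidableEq V] (t : E → Bool → V)

theorem boundaryCard_inter_add_boundaryCard_union_le (X Y : Finset V) :
    boundaryCard t (X ∩ Y) + boundaryCard t (X ∪ Y) ≤ boundaryCard t X + boundaryCard t Y := by
  simp only [boundaryCard, Finset.card_filter, ← Finset.sum_add_distrib]
  refine Finset.sum_le_sum fun e _ => ?_
  by_cases h1 : t e false ∈ X <;> by_cases h2 : t e true ∈ X <;>
    by_cases h3 : t e false ∈ Y <;> by_cases h4 : t e true ∈ Y <;> simp [h1, h2, h3, h4]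

theorem boundaryCard_sdiff_add_boundaryCard_sdiff_le (X Y : Finset V) :
    boundaryCard t (X \ Y) + boundaryCard t (Y \ X) ≤ boundaryCard t X + boundaryCard t Y := by
  simp only [boundaryCard, Finset.card_filter, ← Finset.sum_add_distrib]
  refine Finset.sum_le_sum fun e _ => ?_
  by_cases h1 : t e false ∈ X <;> by_cases h2 : t e true ∈ X <;>
    by_cases h3 : t e false ∈ Y <;> by_cases h4 : t e true ∈ Y <;> simp [h1, h2, h3, h4]

/-- An inclusion-minimal vertex set with exactly one boundary edge. -/
def IsLeafSet (X : Finset V) : Prop :=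
  boundaryCard t X = 1 ∧ ∀ Y ⊆ X, Y ≠ X → boundaryCard t Y ≠ 1

variable {t}

theorem exists_isLeafSet_subset {X : Finset V} (hX : boundaryCard t X = 1) :
    ∃ Y ⊆ X, IsLeafSet t Y := by
  induction X using Finset.strongInduction with
  | H X ih =>
    by_cases h : ∃ Y ⊆ X, Y ≠ X ∧ boundaryCard t Y = 1
    · obtain ⟨Y, hYX, hne, hY⟩ := h
      obtain ⟨Z, hZY, hZ⟩ := ih Y (hYX.ssubset_of_ne hne) hY
      exact ⟨Z, hZY.trans hYX, hZ⟩
    · push Not at h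
      exact ⟨X, subset_rfl, hX, h⟩

theorem boundaryCard_mod_two {r : ℕ} (hr : Odd r)
    (hreg : ∀ v, (Finset.univ.filter fun p : E × Bool => t p.1 p.2 = v).card = r) (Y : Finset V) :
    boundaryCard t Y % 2 = Y.card % 2 := by
  have h := boundaryCard_cast_eq t r hreg Y
  rw [ZMod.natCast_eq_natCast_iff, Nat.ModEq] at h
  rw [h, Nat.mul_mod, Nat.odd_iff.mp hr, one_mul, Nat.mod_mod]

theorem IsLeafSet.eq_of_mem {r : ℕ} (hr : Odd r)
    (hreg : ∀ v, (Finset.univ.filter fun p : E × Bool => t p.1 p.2 = v).card = r)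
    {X Y : Finset V} (hX : IsLeafSet t X) (hY : IsLeafSet t Y) {v : V} (hvX : v ∈ X)
    (hvY : v ∈ Y) : X = Y := by
  have hmod := boundaryCard_mod_two hr hreg
  have h1 := Finset.card_inter_add_card_union X Y
  have h2 := Finset.card_sdiff_add_card_inter X Y
  have h3 := Finset.card_sdiff_add_card_inter Y X
  rw [Finset.inter_comm] at h3
  have h4 := boundaryCard_inter_add_boundaryCard_union_le t X Y
  have h5 := boundaryCard_sdiff_add_boundaryCard_sdiff_le t X Y
  have hXm := hmod X
  have hYm := hmod Y
  have hI := hmod (X ∩ Y)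
  have hU := hmod (X ∪ Y)
  have hXY := hmod (X \ Y)
  have hYX := hmod (Y \ X)
  rw [hX.1, hY.1] at h4 h5
  rw [hX.1] at hXm
  rw [hY.1] at hYm
  rcases Nat.mod_two_eq_zero_or_one (X ∩ Y).card with h | h
  · have h6 : boundaryCard t (X \ Y) = 1 := by omega
    by_contra
    refine hX.2 _ Finset.sdiff_subset (fun h => ?_) h6
    rw [← h] at hvX
    exact (Finset.mem_sdiff.mp hvX).2 hvY
  · have h6 : boundaryCard t (X ∩ Y) = 1 := by omega
    have h7 : X ∩ Y = X := by_contra fun h => hX.2 _ Finset.inter_subset_left h h6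
    have h8 : X ∩ Y = Y := by_contra fun h => hY.2 _ Finset.inter_subset_right h h6
    exact h7.symm.trans h8

theorem card_boundary_factor_cast_eq [DecidableEq E] {c : ℕ} {P : Finset E} {Y : Finset V}
    (hP : ∀ v ∈ Y, (Finset.univ.filter fun p : E × Bool => t p.1 p.2 = v ∧ p.1 ∈ P).card = c) :
    (((P.filter fun e => ¬ (t e false ∈ Y ↔ t e true ∈ Y)).card : ℕ) : ZMod 2) =
      ((c * Y.card : ℕ) : ZMod 2) := by
  have h1 : ((c * Y.card : ℕ) : ZMod 2) =
      ∑ p : E × Bool, if t p.1 p.2 ∈ Y ∧ p.1 ∈ P then (1 : ZMod 2) else 0 := by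
    rw [← Finset.natCast_card_filter, mul_comm, ← smul_eq_mul, ← Finset.sum_const,
      Finset.card_eq_sum_card_fiberwise (f := fun p : E × Bool => t p.1 p.2) (t := Y)]
    · congr 1
      refine Finset.sum_congr rfl fun v hv => ?_
      rw [← hP v hv, Finset.filter_filter]
      congr 1
      ext p
      simp only [Finset.mem_filter, Finset.mem_univ, true_and]
      constructor
      · rintro ⟨rfl, h⟩
        exact ⟨⟨hv, h⟩, rfl⟩
      · rintro ⟨⟨-, h⟩, h'⟩
        exact ⟨h', h⟩
    · intro p hp
      simp only [Finset.coe_filter, Set.mem_ofPred_eq] at hp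
      exact hp.2.1
  have h2 : (P.filter fun e => ¬ (t e false ∈ Y ↔ t e true ∈ Y)) =
      Finset.univ.filter fun e => ¬ (t e false ∈ Y ↔ t e true ∈ Y) ∧ e ∈ P := by
    ext e
    simp [and_comm]
  rw [h1, h2, Finset.natCast_card_filter, Fintype.sum_prod_type]
  refine Finset.sum_congr rfl fun e _ => ?_
  rw [Fintype.sum_bool]
  by_cases h1 : t e false ∈ Y <;> by_cases h2 : t e true ∈ Y <;> by_cases h3 : e ∈ P <;>
    simp [h1, h2, h3]
  decide

theorem IsLeafSet.boundary_edge_unique {X : Finset V} (hX : IsLeafSet t X) {e e' : E}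
    (he : ¬ (t e false ∈ X ↔ t e true ∈ X)) (he' : ¬ (t e' false ∈ X ↔ t e' true ∈ X)) :
    e = e' :=
  Finset.card_le_one.mp hX.1.le e (by simpa using he) e' (by simpa using he')

variable [DecidableEq E]

/-- The unique boundary edge of a leaf set lies in a factor precisely when the factor has odd
degree. -/
theorem IsLeafSet.mem_factor_iff {r : ℕ} (hr : Odd r)
    (hreg : ∀ v, (Finset.univ.filter fun p : E × Bool => t p.1 p.2 = v).card = r)
    {X : Finset V} (hX : IsLeafSet t X) {c : ℕ} {P : Finset E}
    (hP : ∀ v ∈ X, (Finset.univ.filter fun p : E × Bool => t p.1 p.2 = v ∧ p.1 ∈ P).card = c)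
    {e : E} (he : ¬ (t e false ∈ X ↔ t e true ∈ X)) : e ∈ P ↔ Odd c := by
  have h1 := card_boundary_factor_cast_eq hP
  rw [ZMod.natCast_eq_natCast_iff, Nat.ModEq] at h1
  have h2 := boundaryCard_mod_two hr hreg X
  rw [hX.1] at h2
  rw [Nat.mul_mod, ← h2, ← Nat.mul_mod, mul_one] at h1
  have hfilter : (P.filter fun e => ¬ (t e false ∈ X ↔ t e true ∈ X)) = P.filter (· = e) := by
    refine Finset.filter_congr fun e' _ => ⟨fun h => hX.boundary_edge_unique h he, ?_⟩
    rintro rfl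
    exact he
  rw [hfilter, Finset.filter_eq'] at h1
  rw [Nat.odd_iff]
  split_ifs at h1 with h
  · simp only [h, true_iff]
    simpa using h1.symm
  · simp only [h, false_iff]
    simp at h1
    omega

end Uncrossing

/-- A graph of odd degree `r` has a set of edges of even degree `k` at some of the vertices and odd
degree `κ` at the others, none of which joins the two kinds of vertices. -/
theorem exists_factor_of_odd {V E : Type*} [Fintype V] [Fintype E] [DecidableEq V] [DecidableEq E]
    (t : E → Bool → V) {r κ k : ℕ} (hr : Odd r)
    (hreg : ∀ v, (Finset.univ.filter fun p : E × Bool => t p.1 p.2 = v).card = r)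
    (hκ : Odd κ) (hκr : κ < r) (hκ3 : r ≤ 3 * κ)
    (hk : Even k) (hk0 : 0 < k) (hkr : k < r) (hk3 : r ≤ 3 * (r - k)) :
    ∃ (P : Finset E) (A : Finset V), (∀ e ∈ P, (t e false ∈ A ↔ t e true ∈ A)) ∧
      (∀ v ∈ A, (Finset.univ.filter fun p : E × Bool => t p.1 p.2 = v ∧ p.1 ∈ P).card = κ) ∧
      ∀ v ∉ A, (Finset.univ.filter fun p : E × Bool => t p.1 p.2 = v ∧ p.1 ∈ P).card = k := by
  classical
  set W : Finset V := Finset.univ.filter fun v => ∀ X, IsLeafSet t X → v ∉ X with hW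
  have hWleaf : ∀ {v}, v ∉ W → ∃ X, IsLeafSet t X ∧ v ∈ X := by
    intro v hv
    simpa [hW] using hv
  have hℓ : ∀ v, ∃ X, v ∉ W → IsLeafSet t X ∧ v ∈ X := fun v => by
    by_cases hv : v ∈ W
    · exact ⟨∅, fun h => absurd hv h⟩
    · obtain ⟨X, hX⟩ := hWleaf hv
      exact ⟨X, fun _ => hX⟩
  choose ℓ hℓ using hℓ
  have hℓeq : ∀ {v u}, v ∉ W → u ∈ ℓ v → u ∉ W ∧ ℓ u = ℓ v := by
    intro v u hv hu
    have huW : u ∉ W := fun h => (Finset.mem_filter.mp h).2 _ (hℓ v hv).1 hu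
    exact ⟨huW, (hℓ u huW).1.eq_of_mem hr hreg (hℓ v hv).1 (hℓ u huW).2 hu⟩
  obtain ⟨Q, hQ⟩ := exists_factor_on t hreg hκ.pos hκr (Or.inr ⟨hκ, hr, hκ3⟩) (W := W) (by
    intro Y hY _ h
    obtain ⟨Z, hZY, hZ⟩ := exists_isLeafSet_subset h
    obtain ⟨v, hv⟩ : Z.Nonempty := by
      by_contra hne
      have := hZ.1
      simp [Finset.not_nonempty_iff_eq_empty.mp hne, boundaryCard] at this
    exact (Finset.mem_filter.mp (hY (hZY hv))).2 _ hZ hv)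
  have hodd : ∀ X, ∃ P : Finset E, IsLeafSet t X → ∀ v ∈ X,
      (Finset.univ.filter fun p : E × Bool => t p.1 p.2 = v ∧ p.1 ∈ P).card = κ := fun X => by
    by_cases hX : IsLeafSet t X
    · obtain ⟨P, hP⟩ := exists_factor_on t hreg hκ.pos hκr (Or.inr ⟨hκ, hr, hκ3⟩) hX.2
      exact ⟨P, fun _ => hP⟩
    · exact ⟨∅, fun h => absurd h hX⟩
  have heven : ∀ X, ∃ P : Finset E, IsLeafSet t X → ∀ v ∈ X,
      (Finset.univ.filter fun p : E × Bool => t p.1 p.2 = v ∧ p.1 ∈ P).card = k := fun X => by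
    by_cases hX : IsLeafSet t X
    · obtain ⟨P, hP⟩ := exists_factor_on t hreg hk0 hkr (Or.inl ⟨hk, hk3⟩) hX.2
      exact ⟨P, fun _ => hP⟩
    · exact ⟨∅, fun h => absurd h hX⟩
  choose QA hQA using hodd
  choose QB hQB using heven
  set A : Finset V := Finset.univ.filter fun v => v ∈ W ∨
    ∃ e ∈ Q, (t e false ∈ W ∨ t e true ∈ W) ∧ ¬ (t e false ∈ ℓ v ↔ t e true ∈ ℓ v) with hA
  have hAmem : ∀ v, v ∈ A ↔ v ∈ W ∨
      ∃ e ∈ Q, (t e false ∈ W ∨ t e true ∈ W) ∧ ¬ (t e false ∈ ℓ v ↔ t e true ∈ ℓ v) := by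
    simp [hA]
  set P : Finset E := Finset.univ.filter fun e =>
    if t e false ∈ W ∨ t e true ∈ W then e ∈ Q
    else ℓ (t e false) = ℓ (t e true) ∧
      if t e false ∈ A then e ∈ QA (ℓ (t e false)) else e ∈ QB (ℓ (t e false)) with hP
  have hPmem : ∀ e, e ∈ P ↔ if t e false ∈ W ∨ t e true ∈ W then e ∈ Q
      else ℓ (t e false) = ℓ (t e true) ∧
        if t e false ∈ A then e ∈ QA (ℓ (t e false)) else e ∈ QB (ℓ (t e false)) := by
    simp [hP]
  clear_value A P
  have hAeq : ∀ {u v}, u ∉ W → v ∉ W → ℓ u = ℓ v → (u ∈ A ↔ v ∈ A) := by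
    intro u v hu hv huv
    simp only [hAmem, hu, hv, huv, false_or]
  have hmemW : ∀ {v u}, v ∉ W → u ∈ W → u ∉ ℓ v := fun hv hu h => (hℓeq hv h).1 hu
  have hcross : ∀ e b, t e b ∈ W → t e (!b) ∉ W → e ∈ Q → t e (!b) ∈ A := by
    intro e b h1 h2 h3
    refine (hAmem _).mpr (Or.inr ⟨e, h3, by cases b <;> simp [h1], ?_⟩)
    have h4 := (hℓ _ h2).2
    have h5 := hmemW h2 h1
    cases b
    · exact fun h => h5 (h.mpr h4)
    · exact fun h => h5 (h.mp h4)
  refine ⟨P, A, fun e he => ?_, fun v hv => ?_, fun v hv => ?_⟩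
  · rw [hPmem] at he
    have hWA : ∀ {v}, v ∈ W → v ∈ A := fun h => (hAmem _).mpr (Or.inl h)
    split_ifs at he with h1 h2
    · have h3 := hcross e false
      have h4 := hcross e true
      simp only [Bool.not_false, Bool.not_true] at h3 h4
      have h5 : t e false ∈ A := by
        by_cases h : t e false ∈ W
        · exact hWA h
        · exact h4 (h1.resolve_left h) h he
      have h6 : t e true ∈ A := by
        by_cases h : t e true ∈ W
        · exact hWA h
        · exact h3 (h1.resolve_right h) h he
      exact iff_of_true h5 h6
    all_goals
      push Not at h1
      exact hAeq h1.1 h1.2 he.1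
  · by_cases hvW : v ∈ W
    · rw [← hQ v hvW]
      congr 1
      refine Finset.filter_congr fun p _ => and_congr_right ?_
      rintro rfl
      rw [hPmem, if_pos]
      rcases p with ⟨e, b⟩
      cases b
      · exact Or.inl hvW
      · exact Or.inr hvW
    · obtain ⟨hX, hvX⟩ := hℓ v hvW
      obtain ⟨e₀, he₀, he₀W, he₀X⟩ := ((hAmem v).mp hv).resolve_left hvW
      rw [← hQA _ hX v hvX]
      congr 1
      refine Finset.filter_congr fun ⟨e, b⟩ _ => and_congr_right fun hev => ?_
      dsimp only at hev ⊢
      have hmem : t e b ∈ ℓ v := by rwa [hev]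
      by_cases he : t e false ∈ ℓ v ↔ t e true ∈ ℓ v
      · have h1 : t e false ∈ ℓ v ∧ t e true ∈ ℓ v := by
          cases b
          · exact ⟨hmem, he.mp hmem⟩
          · exact ⟨he.mpr hmem, hmem⟩
        obtain ⟨h2, h3⟩ := hℓeq hvW h1.1
        obtain ⟨h4, h5⟩ := hℓeq hvW h1.2
        rw [hPmem, if_neg (by tauto), if_pos ((hAeq h2 hvW h3).mpr hv), h3, h5]
        simp
      · obtain rfl := hX.boundary_edge_unique he he₀X
        rw [hX.mem_factor_iff hr hreg (hQA _ hX) he, hPmem, if_pos he₀W]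
        exact iff_of_true he₀ hκ
  · have hvW : v ∉ W := fun h => hv ((hAmem v).mpr (Or.inl h))
    obtain ⟨hX, hvX⟩ := hℓ v hvW
    rw [← hQB _ hX v hvX]
    congr 1
    refine Finset.filter_congr fun ⟨e, b⟩ _ => and_congr_right fun hev => ?_
    dsimp only at hev ⊢
    have hmem : t e b ∈ ℓ v := by rwa [hev]
    by_cases he : t e false ∈ ℓ v ↔ t e true ∈ ℓ v
    · have h1 : t e false ∈ ℓ v ∧ t e true ∈ ℓ v := by
        cases b
        · exact ⟨hmem, he.mp hmem⟩
        · exact ⟨he.mpr hmem, hmem⟩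
      obtain ⟨h2, h3⟩ := hℓeq hvW h1.1
      obtain ⟨h4, h5⟩ := hℓeq hvW h1.2
      rw [hPmem, if_neg (by tauto), if_neg ((hAeq h2 hvW h3).not.mpr hv), h3, h5]
      simp
    · rw [hX.mem_factor_iff hr hreg (hQB _ hX) he, hPmem]
      refine iff_of_false ?_ (Nat.not_odd_iff_even.mpr hk)
      split_ifs with h1 h2
      · exact fun heQ => hv ((hAmem v).mpr (Or.inr ⟨e, heQ, h1, he⟩))
      all_goals
        push Not at h1
        rintro ⟨h3, -⟩
        have h4 := (hℓ _ h1.1).2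
        have h5 := (hℓ _ h1.2).2
        refine he (iff_of_true ?_ ?_)
        · cases b
          · exact hmem
          · rwa [← hev, ← h3]
        · cases b
          · rwa [← hev, h3]
          · exact hmem

/-- Every graph of degree `r ≥ 3`, `r ≠ 5`, has a zero-sum `5`-flow, in terms of half-edges. -/
theorem exists_flow_of_regular {V E : Type*} [Fintype V] [Fintype E] [DecidableEq V]
    [DecidableEq E] (t : E → Bool → V) {r : ℕ} (hr3 : 3 ≤ r) (hr5 : r ≠ 5)
    (hreg : ∀ v, (Finset.univ.filter fun p : E × Bool => t p.1 p.2 = v).card = r) :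
    ∃ f : E → ℤ, (∀ e, f e ≠ 0 ∧ |f e| ≤ 4) ∧
      ∀ v, ∑ p : E × Bool, (if t p.1 p.2 = v then f p.1 else 0) = 0 := by
  rcases Nat.even_or_odd r with hr | hr
  · have hr2 := Nat.even_iff.mp hr
    obtain ⟨P, hP⟩ := exists_factor_on t hreg (k := 2 * (r / 4)) (W := Finset.univ) (by omega)
      (by omega) (Or.inl ⟨even_two_mul _, by omega⟩) (by
        intro Y _ _ h
        have h1 := boundaryCard_cast_eq t r hreg Y
        rw [h, ZMod.natCast_eq_natCast_iff, Nat.ModEq, Nat.mul_mod, hr2] at h1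
        simp at h1)
    exact exists_flow_of_factor t hreg P Finset.univ (h := r / 3) (by simp) hP (by simp)
      (by omega) (by omega) (by omega) (by omega)
  · have hr2 := Nat.odd_iff.mp hr
    obtain ⟨P, A, hPA, hA, hB⟩ := exists_factor_of_odd t (κ := 2 * ((r + 1) / 4) - 1)
      (k := 2 * ((r + 1) / 4)) hr hreg (Nat.odd_iff.mpr (by omega)) (by omega) (by omega)
      (even_two_mul _) (by omega) (by omega) (by omega)
    exact exists_flow_of_factor t hreg P A hPA hA hB (by omega) (by omega) (by omega) (by omega)

namespace Multigraph

variable {V E : Type*} [Fintype E] [DecidableEq V]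

/-- Sums over the edges incident with `v` are sums over the half-edges at `v`. -/
theorem sum_incidence_eq {M : Type*} [AddCommMonoid M] (G : Multigraph V E) {t : E → Bool → V}
    (ht : ∀ e, G.ends e = s(t e false, t e true)) (f : E → M) (v : V) :
    ∑ e ∈ G.incidence v, f e = ∑ p : E × Bool, if t p.1 p.2 = v then f p.1 else 0 := by
  rw [incidence, Finset.sum_filter, Fintype.sum_prod_type]
  refine Finset.sum_congr rfl fun e _ => ?_
  have h := G.loopless e
  rw [ht, Sym2.mk_isDiag_iff] at h
  rw [Fintype.sum_bool]
  by_cases h1 : t e false = v <;> by_cases h2 : t e true = v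
  · exact absurd (h1.trans h2.symm) h
  all_goals
    have h3 : (v = t e false ∨ v = t e true) ↔ (t e false = v ∨ t e true = v) := by
      rw [eq_comm (a := v), eq_comm (a := v)]
    simp [ht, h3, h1, h2]

end Multigraph

/-- For every integer `r ≥ 3` with `r ≠ 5`, every `r`-regular graph admits a
zero-sum 5-flow. -/
theorem r_regular_admits_zero_sum_five_flow
    {V E : Type*} [Fintype V] [Fintype E] [DecidableEq V]
    (r : ℕ) (hr : 3 ≤ r) (hr5 : r ≠ 5)
    (G : Multigraph V E) (hreg : ∀ v, G.degree v = r) :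
    ∃ f : E → ℤ, G.IsZeroSumKFlow 5 f := by
  classical
  have hends : ∀ e, ∃ t : Bool → V, G.ends e = s(t false, t true) := fun e => by
    induction G.ends e with
    | _ x y => exact ⟨fun b => cond b y x, rfl⟩
  choose t ht using hends
  obtain ⟨f, hf, hsum⟩ := exists_flow_of_regular t hr hr5 fun v => by
    rw [← hreg v, Multigraph.degree, Finset.card_eq_sum_ones (G.incidence v), G.sum_incidence_eq ht,
      Finset.card_filter]
  refine ⟨f, ⟨fun e => (hf e).1, fun v => ?_⟩, fun e => ?_⟩
  · rw [G.sum_incidence_eq ht]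
    exact hsum v
  · simpa using (hf e).2.trans (by norm_num)
end

section
/- Let G be a connected graph and let u_1, u_2, ..., u_{2m} (m ≥ 1) be 2m distinct vertices of G. Then there exist m pairwise edge-disjoint paths in G such that the 2m end-vertices of these m paths are pairwise distinct and form the set {u_1, u_2, ..., u_{2m}}. -/
namespace Multigraph

variable {V E : Type*}

/-- A path in a multigraph: a list of pairwise distinct vertices together with a
list of edges joining the consecutive vertices. -/
structure MPath (G : Multigraph V E) where
  verts : List V
  edges : List E
  length_eq : verts.length = edges.length + 1
  nodup : verts.Nodup
  valid : ∀ i (hi : i < edges.length),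
    G.ends (edges.get ⟨i, hi⟩) =
      s(verts.get ⟨i, by omega⟩, verts.get ⟨i + 1, by omega⟩)

/-- The first end-vertex of a path. -/
def MPath.first {G : Multigraph V E} (p : G.MPath) : V :=
  p.verts.get ⟨0, by have := p.length_eq; omega⟩

/-- The last end-vertex of a path. -/
def MPath.last {G : Multigraph V E} (p : G.MPath) : V :=
  p.verts.get ⟨p.verts.length - 1, by have := p.length_eq; omega⟩

end Multigraph

namespace SimpleGraph

/-- An edge of a shortest walk from `a` to `b` splits the distance from `a` to `b`. -/
theorem Walk.exists_dist_add_one_add_dist_le_length {V : Type*} {H : SimpleGraph V} {a b : V}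
    (p : H.Walk a b) {e : Sym2 V} (he : e ∈ p.edges) :
    ∃ v w, e = s(v, w) ∧ H.dist a v + 1 + H.dist w b ≤ p.length := by
  induction p with
  | nil => simp at he
  | @cons a c b h p ih =>
    rw [Walk.edges_cons, List.mem_cons] at he
    rcases he with rfl | he
    · refine ⟨a, c, rfl, ?_⟩
      have := dist_le p
      simp only [dist_self, Walk.length_cons]
      omega
    · obtain ⟨v, w, rfl, hle⟩ := ih he
      refine ⟨v, w, rfl, ?_⟩
      have := h.reachable.dist_triangle_left v
      rw [dist_eq_one_iff_adj.mpr h] at this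
      simp only [Walk.length_cons]
      omega

/-- If shortest walks from `a` to `b` and from `c` to `d` share an edge, then the four ends can be
paired up again at a smaller total distance. -/
theorem Connected.dist_add_dist_lt_of_mem_edges {V : Type*} {H : SimpleGraph V} (hH : H.Connected)
    {a b c d : V} {p : H.Walk a b} {q : H.Walk c d} (hp : p.length = H.dist a b)
    (hq : q.length = H.dist c d) {e : Sym2 V} (hep : e ∈ p.edges) (heq : e ∈ q.edges) :
    H.dist a c + H.dist b d < H.dist a b + H.dist c d ∨
      H.dist a d + H.dist b c < H.dist a b + H.dist c d := by
  obtain ⟨v, w, rfl, h₁⟩ := p.exists_dist_add_one_add_dist_le_length hep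
  obtain ⟨x, y, hxy, h₂⟩ := q.exists_dist_add_one_add_dist_le_length heq
  rcases Sym2.eq_iff.mp hxy with ⟨rfl, rfl⟩ | ⟨rfl, rfl⟩
  · left
    have h₃ := hH.dist_triangle (u := a) (v := v) (w := c)
    have h₄ := hH.dist_triangle (u := b) (v := w) (w := d)
    rw [H.dist_comm (u := v) (v := c)] at h₃
    rw [H.dist_comm (u := b) (v := w)] at h₄
    omega
  · right
    have h₃ := hH.dist_triangle (u := a) (v := v) (w := d)
    have h₄ := hH.dist_triangle (u := b) (v := w) (w := c)
    rw [H.dist_comm (u := b) (v := w), H.dist_comm (u := w) (v := c)] at h₄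
    omega

end SimpleGraph

namespace Multigraph

/-- A path of the simple graph of adjacencies lifts to a path of the multigraph. -/
theorem exists_mpath_of_isPath {V E : Type*} {G : Multigraph V E} {F : Set E} {a b : V}
    (p : (G.supportGraph F).Walk a b) (hp : p.IsPath) :
    ∃ q : G.MPath, q.verts = p.support ∧ ∀ e ∈ q.edges, G.ends e ∈ p.edges := by
  induction p with
  | nil => exact ⟨⟨[_], [], rfl, by simp, by simp⟩, rfl, by simp⟩
  | @cons a c b h p ih =>
    obtain ⟨q, hq, hqe⟩ := ih hp.of_cons
    obtain ⟨-, e, -, he⟩ := id h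
    have hq₀ : q.verts[0]'(by have := q.length_eq; omega) = c := by
      simp [hq, SimpleGraph.Walk.support_getElem_zero]
    refine ⟨⟨a :: q.verts, e :: q.edges, by simp [q.length_eq], ?_, ?_⟩, ?_, ?_⟩
    · have := hp.support_nodup
      rwa [SimpleGraph.Walk.support_cons, ← hq] at this
    · rintro (_ | i) hi
      · simp [he, hq₀]
      · simpa using q.valid i (by simpa using hi)
    · simp [hq]
    · intro f hf
      rcases List.mem_cons.mp hf with rfl | hf
      · simp [he]
      · simp [hqe f hf]

theorem MPath.first_eq_of_verts_eq_support {V E : Type*} {G : Multigraph V E} {F : Set E} {a b : V}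
    {p : (G.supportGraph F).Walk a b} {q : G.MPath} (h : q.verts = p.support) : q.first = a := by
  simp [MPath.first, h]

theorem MPath.last_eq_of_verts_eq_support {V E : Type*} {G : Multigraph V E} {F : Set E} {a b : V}
    {p : (G.supportGraph F).Walk a b} {q : G.MPath} (h : q.verts = p.support) : q.last = b := by
  simp [MPath.last, h]

end Multigraph

/-- Changing a function at two places changes two summands of a sum along it. -/
theorem Finset.exists_sum_update_update {ι α M : Type*} [Fintype ι] [DecidableEq ι]
    [AddCommMonoid M] (g : α → M) (f : ι → α) {i j : ι} (hij : i ≠ j) (x y : α) :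
    ∃ r, ∑ k, g (f k) = g (f i) + g (f j) + r ∧
      ∑ k, g (Function.update (Function.update f i x) j y k) = g x + g y + r := by
  have key (f' : ι → α) :
      ∑ k, g (f' k) = g (f' i) + g (f' j) + ∑ k ∈ ({i, j} : Finset ι)ᶜ, g (f' k) := by
    rw [← Finset.sum_add_sum_compl {i, j}, Finset.sum_pair hij]
  refine ⟨_, key f, (key _).trans ?_⟩
  congr 1
  · simp [hij]
  · refine Finset.sum_congr rfl fun k hk => ?_
    simp only [Finset.mem_compl, Finset.mem_insert, Finset.mem_singleton, not_or] at hk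
    simp [hk.1, hk.2]

/-- The values of a family indexed by `Fin (2 * m)` can be grouped into `m` pairs. -/
theorem Fin.exists_sum_pair_eq_map {V : Type*} (m : ℕ) (u : Fin (2 * m) → V) :
    ∃ f : Fin m → V × V, ∑ i, ({(f i).1, (f i).2} : Multiset V) = Finset.univ.val.map u := by
  let φ : Fin m × Fin 2 ≃ Fin (2 * m) := finProdFinEquiv.trans (finCongr (mul_comm m 2))
  refine ⟨fun i => (u (φ (i, 0)), u (φ (i, 1))), ?_⟩
  have h : Finset.univ.val.map u = ∑ x, ({u x} : Multiset V) :=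
    (Multiset.bind_singleton _ _).symm
  rw [h, ← φ.sum_comp, Fintype.sum_prod_type]
  simp [Fin.sum_univ_two, Multiset.insert_eq_cons, Multiset.singleton_add]

/-- A multiset that splits into `m` pairs of vertices of a connected graph splits into `m` pairs
such that shortest walks joining the pairs are edge-disjoint. -/
theorem SimpleGraph.Connected.exists_pairing_disjoint_edges {V ι : Type*} [Fintype ι]
    {H : SimpleGraph V} (hH : H.Connected) (f₀ : ι → V × V) :
    ∃ f : ι → V × V, ∑ i, ({(f i).1, (f i).2} : Multiset V) = ∑ i, {(f₀ i).1, (f₀ i).2} ∧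
      ∀ i j, i ≠ j → ∀ (p : H.Walk (f i).1 (f i).2) (q : H.Walk (f j).1 (f j).2),
        p.length = H.dist (f i).1 (f i).2 → q.length = H.dist (f j).1 (f j).2 →
          p.edges.Disjoint q.edges := by
  classical
  let S : Set (ι → V × V) :=
    {f | ∑ i, ({(f i).1, (f i).2} : Multiset V) = ∑ i, {(f₀ i).1, (f₀ i).2}}
  obtain ⟨f, hf, hmin⟩ := (measure fun f : ι → V × V => ∑ i, H.dist (f i).1 (f i).2).wf.has_min S
    ⟨f₀, rfl⟩
  refine ⟨f, hf, fun i j hij p q hp hq e hep heq => ?_⟩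
  have swap (x y : V × V)
      (hxy : ({x.1, x.2} + {y.1, y.2} : Multiset V) = {(f i).1, (f i).2} + {(f j).1, (f j).2}) :
      ¬ H.dist x.1 x.2 + H.dist y.1 y.2 < H.dist (f i).1 (f i).2 + H.dist (f j).1 (f j).2 := by
    intro hlt
    obtain ⟨r, hr, hr'⟩ := Finset.exists_sum_update_update
      (fun z : V × V => ({z.1, z.2} : Multiset V)) f hij x y
    obtain ⟨t, ht, ht'⟩ := Finset.exists_sum_update_update
      (fun z : V × V => H.dist z.1 z.2) f hij x y
    refine hmin (Function.update (Function.update f i x) j y) ?_ ?_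
    · exact (hr'.trans (by rw [hxy, ← hr])).trans hf
    · exact ht'.trans_lt ((Nat.add_lt_add_right hlt t).trans_eq ht.symm)
  rcases hH.dist_add_dist_lt_of_mem_edges hp hq hep heq with h | h
  · refine swap ((f i).1, (f j).1) ((f i).2, (f j).2) ?_ h
    simp only [Multiset.insert_eq_cons, ← Multiset.singleton_add]
    abel
  · refine swap ((f i).1, (f j).2) ((f i).2, (f j).1) ?_ h
    simp only [Multiset.insert_eq_cons, ← Multiset.singleton_add]
    abel

/-- In a connected graph `G`, for any `2m` distinct vertices `u 0, …, u (2m-1)`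
(`m ≥ 1`) there are `m` pairwise edge-disjoint paths whose `2m` end-vertices are
pairwise distinct and form the set `{u 0, …, u (2m-1)}` (expressed by saying the
multiset of the `2m` end-vertices equals the multiset of the `u i`'s). -/
theorem edge_disjoint_paths_with_prescribed_ends
    {V E : Type*} [Fintype V] [Fintype E] [DecidableEq V]
    (G : Multigraph V E)
    (hconn : ∀ v w : V, (G.supportGraph Set.univ).Reachable v w)
    (m : ℕ) (hm : 1 ≤ m) (u : Fin (2 * m) → V) (hu : Function.Injective u) :
    ∃ P : Fin m → G.MPath,
      (∀ i j, i ≠ j → ∀ e, e ∈ (P i).edges → e ∉ (P j).edges) ∧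
      (Finset.univ.val.bind fun i => {(P i).first, (P i).last}) =
        Finset.univ.val.map u := by
  obtain ⟨f₀, hf₀⟩ := Fin.exists_sum_pair_eq_map m u
  have : Nonempty V := ⟨u ⟨0, by omega⟩⟩
  have hH : (G.supportGraph Set.univ).Connected := ⟨hconn⟩
  obtain ⟨f, hf, hdisj⟩ := hH.exists_pairing_disjoint_edges f₀
  choose p hp hlen using fun i => hH.exists_path_of_dist (f i).1 (f i).2
  choose P hP hPe using fun i => Multigraph.exists_mpath_of_isPath (p i) (hp i)
  refine ⟨P, fun i j hij e hi hj =>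
    hdisj i j hij (p i) (p j) (hlen i) (hlen j) (hPe i e hi) (hPe j e hj), ?_⟩
  rw [← hf₀, ← hf]
  simp only [Multigraph.MPath.first_eq_of_verts_eq_support (hP _),
    Multigraph.MPath.last_eq_of_verts_eq_support (hP _)]
  rfl
end

section
/- Every cycle-cubic tree G relative to a family R = {R_1, R_2, ..., R_t}, whose maximum degree is at most 5, admits an integer-valued function f on its edge set such that: f(e) ∈ {4, 5} if e is an edge of some R_i which is a cycle; f(e) ∈ {1, 2, 3} if e is an edge of some R_i which is a cubic graph; f(e) ∈ {−2, −4} if e is an edge of G outside R_1 ∪ ... ∪ R_t; and for each vertex u of G, the sum of f over all edges incident with u equals 0 if deg(u) = 5, equals 3 if deg(u) = 4, equals 6 if deg(u) = 3, and equals 9 if deg(u) = 2. -/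
/-- A *cycle-cubic tree*: a multigraph `G` together with a family of `t`
pairwise vertex-disjoint connected subgraphs `R_1, …, R_t` (given by the vertex
partition `part` and the edge sets `Redges`) covering all vertices, such that
each `R_i` is a cycle (connected 2-regular) or a cubic graph (connected
3-regular), every edge of `G` lies in some `R_i` or joins two different `R_i`'s,
the graph obtained by contracting each `R_i` to a single vertex is a tree, and
the degree of the contracted vertex of `R_i` in this tree is even exactly when
`R_i` is an even cycle or a cubic graph (hence odd exactly when `R_i` is an odd
cycle). -/
structure CycleCubicTree (V E : Type*) [Fintype V] [Fintype E] [DecidableEq V]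
    extends Multigraph V E where
  /-- the number of members of the family -/
  t : ℕ
  t_pos : 0 < t
  /-- `part v` is the index of the member `R_i` containing the vertex `v`;
  the members are pairwise vertex-disjoint and cover `V`. -/
  part : V → Fin t
  part_surj : Function.Surjective part
  /-- the edge set of the member `R_i` -/
  Redges : Fin t → Finset E
  /-- the edges of `R_i` join vertices of `R_i` -/
  ends_mem_part : ∀ i, ∀ e ∈ Redges i, ∀ v ∈ toMultigraph.ends e, part v = i
  /-- every edge of `G` lies in some `R_i` or joins two different members -/
  edge_cover : ∀ e, (∃ i, e ∈ Redges i) ∨ ¬ ((toMultigraph.ends e).map part).IsDiag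
  /-- each member `R_i` is connected -/
  part_conn : ∀ i, ∀ v w, part v = i → part w = i →
    (toMultigraph.supportGraph ↑(Redges i)).Reachable v w
  /-- each member `R_i` is a cycle (2-regular) or a cubic graph (3-regular) -/
  cycle_or_cubic : ∀ i,
    (∀ v, part v = i → toMultigraph.degIn (Redges i) v = 2) ∨
    (∀ v, part v = i → toMultigraph.degIn (Redges i) v = 3)
  /-- the contracted graph `G_R` is connected … -/
  quot_conn : ∀ i j : Fin t,
    Relation.ReflTransGen
      (fun a b => a ≠ b ∧ ∃ e, (toMultigraph.ends e).map part = s(a, b)) i j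
  /-- … and has exactly `t - 1` edges, hence is a tree -/
  quot_tree : (Finset.univ.filter
      fun e => ¬ ((toMultigraph.ends e).map part).IsDiag).card = t - 1
  /-- the degree of the contracted vertex of `R_i` in `G_R` is even iff `R_i` is
  an even cycle or a cubic graph -/
  parity : ∀ i : Fin t,
    Even ((Finset.univ.filter
        fun e => ¬ ((toMultigraph.ends e).map part).IsDiag ∧
          i ∈ (toMultigraph.ends e).map part).card) ↔
      ((∀ v, part v = i → toMultigraph.degIn (Redges i) v = 2) ∧
          Even (Finset.univ.filter (fun v => part v = i)).card) ∨
        (∀ v, part v = i → toMultigraph.degIn (Redges i) v = 3)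

namespace Multigraph

variable {V E : Type*} [Fintype E] [DecidableEq V]

/-- Every even subset `T` of `S` is the set of vertices with nonzero sum of some `{-1,0,1}`-valued
function on the edges of `F` inside `S`, all of whose vertex sums lie in `{-1,0,1}`. -/
def HasSignedJoins (G : Multigraph V E) (F : Finset E) (S : Finset V) : Prop :=
  ∀ T ⊆ S, Even T.card → ∃ x : E → ℤ,
    (∀ e, x e = 0 ∨ x e = 1 ∨ x e = -1) ∧ (∀ e ∉ F, x e = 0) ∧
    (∀ e, ∀ v ∈ G.ends e, v ∉ S → x e = 0) ∧
    ∀ v, (v ∈ T → ∑ e ∈ G.incidence v, x e = 1 ∨ ∑ e ∈ G.incidence v, x e = -1) ∧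
      (v ∉ T → ∑ e ∈ G.incidence v, x e = 0)

theorem hasSignedJoins_singleton (G : Multigraph V E) (F : Finset E) (v : V) :
    G.HasSignedJoins F {v} := by
  intro T hT heven
  obtain rfl | rfl := Finset.subset_singleton_iff.1 hT
  · exact ⟨0, by simp, by simp, by simp, by simp⟩
  · simp at heven

theorem sum_incidence_update [DecidableEq E] (G : Multigraph V E) (x : E → ℤ) (e : E) (c : ℤ)
    (he : x e = 0) (u : V) :
    ∑ e' ∈ G.incidence u, Function.update x e c e' =
      ∑ e' ∈ G.incidence u, x e' + if u ∈ G.ends e then c else 0 := by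
  have h : Function.update x e c = fun e' => x e' + if e' = e then c else 0 := by
    ext e'
    by_cases h : e' = e
    · subst h; simp [he]
    · simp [h]
  rw [h, Finset.sum_add_distrib, Finset.sum_ite_eq']
  simp [incidence]

theorem HasSignedJoins.insert {G : Multigraph V E} {F : Finset E} {S : Finset V}
    (hS : G.HasSignedJoins F S) {p v : V} {e : E} (hp : p ∈ S) (hv : v ∉ S) (he : e ∈ F)
    (hends : G.ends e = s(p, v)) : G.HasSignedJoins F (insert v S) := by
  classical
  intro T hT heven
  have hpv : p ≠ v := fun h => hv (h ▸ hp)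
  by_cases hvT : v ∈ T
  swap
  · obtain ⟨x, h1, h2, h3, h4⟩ := hS T ((Finset.subset_insert_iff_of_notMem hvT).1 hT) heven
    exact ⟨x, h1, h2, fun e' u hu huS => h3 e' u hu fun h => huS (Finset.mem_insert_of_mem h), h4⟩
  have hTS : T.erase v ⊆ S := Finset.subset_insert_iff.1 hT
  have extend : ∀ T' ⊆ S, Even T'.card → (∀ u, u ≠ p → u ≠ v → (u ∈ T' ↔ u ∈ T)) →
      (p ∈ T' ↔ p ∉ T) → ∃ x : E → ℤ,
      (∀ e, x e = 0 ∨ x e = 1 ∨ x e = -1) ∧ (∀ e ∉ F, x e = 0) ∧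
      (∀ e, ∀ u ∈ G.ends e, u ∉ Insert.insert v S → x e = 0) ∧
      ∀ v, (v ∈ T → ∑ e ∈ G.incidence v, x e = 1 ∨ ∑ e ∈ G.incidence v, x e = -1) ∧
      (v ∉ T → ∑ e ∈ G.incidence v, x e = 0) := by
    intro T' hT' heven' hother hpT
    obtain ⟨x, h1, h2, h3, h4⟩ := hS T' hT' heven'
    have hxe : x e = 0 := h3 e v (by simp [hends]) hv
    have hsumv : ∑ e ∈ G.incidence v, x e = 0 := (h4 v).2 fun h => hv (hT' h)
    obtain ⟨c, hc, hcp⟩ : ∃ c : ℤ, (c = 1 ∨ c = -1) ∧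
        (p ∉ T → ∑ e ∈ G.incidence p, x e + c = 0) := by
      by_cases h : p ∈ T
      · exact ⟨1, .inl rfl, fun h' => absurd h h'⟩
      · refine ⟨-∑ e ∈ G.incidence p, x e, ?_, fun _ => by ring⟩
        rcases (h4 p).1 (hpT.2 h) with h | h <;> simp [h]
    refine ⟨Function.update x e c, ?_, ?_, ?_, ?_⟩
    · intro e'
      by_cases h : e' = e
      · subst h; simp [hc]
      · simpa [h] using h1 e'
    · intro e' he'
      have h : e' ≠ e := fun h => he' (h ▸ he)
      simpa [h] using h2 e' he'
    · intro e' u hu huS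
      by_cases h : e' = e
      · subst h
        rw [hends, Sym2.mem_iff] at hu
        rcases hu with rfl | rfl <;> simp_all
      · simpa [h] using h3 e' u hu fun h => huS (Finset.mem_insert_of_mem h)
    · intro u
      rw [G.sum_incidence_update x e c hxe, hends]
      by_cases huv : u = v
      · subst huv
        simp [hsumv, hvT, hc]
      by_cases hup : u = p
      · subst hup
        have h0 := (h4 u).2
        simp only [Sym2.mem_iff, true_or, if_true]
        refine ⟨fun h => ?_, hcp⟩
        rw [h0 fun h' => hpT.1 h' h, zero_add]
        exact hc
      · simpa [huv, hup, hother u hup huv] using h4 u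
  have hcard := Finset.card_erase_add_one hvT
  by_cases hpT : p ∈ T
  · have hmem : p ∈ T.erase v := Finset.mem_erase.2 ⟨hpv, hpT⟩
    have hcard' := Finset.card_erase_add_one hmem
    refine extend ((T.erase v).erase p) ((Finset.erase_subset _ _).trans hTS) ?_ ?_ ?_
    · rw [← hcard, ← hcard'] at heven
      simpa [add_assoc, Nat.even_add] using heven
    · intro u h h'; simp [h, h']
    · simp [hpT]
  · have hmem : p ∉ T.erase v := fun h => hpT (Finset.mem_of_mem_erase h)
    refine extend (Insert.insert p (T.erase v)) (Finset.insert_subset hp hTS) ?_ ?_ ?_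
    · rwa [Finset.card_insert_of_notMem hmem, hcard]
    · intro u h h'; simp [h, h']
    · simp [hpT]

theorem hasSignedJoins_of_reachable {G : Multigraph V E} {F : Finset E} {W : Finset V}
    (hF : ∀ e ∈ F, ∀ v ∈ G.ends e, v ∈ W) (hW : W.Nonempty)
    (hconn : ∀ v ∈ W, ∀ w ∈ W, (G.supportGraph ↑F).Reachable v w) :
    G.HasSignedJoins F W := by
  classical
  obtain ⟨r, hr⟩ := hW
  obtain ⟨S, hS, hmax⟩ := Finset.exists_max_image
    (W.powerset.filter fun S => S.Nonempty ∧ G.HasSignedJoins F S) Finset.card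
    ⟨{r}, by simp [hr, hasSignedJoins_singleton]⟩
  simp only [Finset.mem_filter, Finset.mem_powerset] at hS hmax
  obtain ⟨hSW, ⟨s, hs⟩, hjoin⟩ := hS
  by_cases hWS : W ⊆ S
  · rwa [hWS.antisymm hSW]
  obtain ⟨v, hvW, hvS⟩ := Finset.not_subset.1 hWS
  obtain ⟨walk⟩ := hconn s (hSW hs) v hvW
  obtain ⟨d, -, hd1, hd2⟩ := walk.exists_boundary_dart (S : Set V) hs hvS
  obtain ⟨-, e, he, hends⟩ := d.adj
  have hdS : d.snd ∉ S := hd2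
  have := hmax (insert d.snd S) ⟨Finset.insert_subset (hF e he _ (by simp [hends])) hSW,
    Finset.insert_nonempty _ _, hjoin.insert hd1 hdS he hends⟩
  rw [Finset.card_insert_of_notMem hdS] at this
  omega

end Multigraph

theorem exists_sign_sum_eq {α : Type*} (A : Finset α) (s : ℤ)
    (hs : (Even A.card ∧ s = 0) ∨ (¬ Even A.card ∧ (s = 1 ∨ s = -1))) :
    ∃ σ : α → ℤ, (∀ a, σ a = 1 ∨ σ a = -1) ∧ ∑ a ∈ A, σ a = s := by
  classical
  induction A using Finset.induction_on generalizing s with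
  | empty => exact ⟨1, by simp, by simp_all⟩
  | insert a A ha ih =>
    rw [Finset.card_insert_of_notMem ha, Nat.even_add_one] at hs
    obtain ⟨c, hc, hs'⟩ : ∃ c : ℤ, (c = 1 ∨ c = -1) ∧
        ((Even A.card ∧ s - c = 0) ∨ (¬ Even A.card ∧ (s - c = 1 ∨ s - c = -1))) := by
      rcases hs with ⟨h, rfl⟩ | ⟨h, h'⟩
      · exact ⟨1, .inl rfl, .inr ⟨h, by simp⟩⟩
      · exact ⟨s, h', .inl ⟨not_not.1 h, by simp⟩⟩
    obtain ⟨σ, h1, h2⟩ := ih _ hs'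
    refine ⟨Function.update σ a c, fun b => ?_, ?_⟩
    · by_cases h : b = a
      · subst h; simpa using hc
      · simpa [h] using h1 b
    · rw [Finset.sum_insert ha, Finset.sum_update_of_notMem ha, h2]
      simp

namespace CycleCubicTree

variable {V E : Type*} [Fintype V] [Fintype E] [DecidableEq V] (T : CycleCubicTree V E)

/-- `e` joins two different members of the family. -/
def IsTreeEdge (e : E) : Prop := ¬ ((T.ends e).map T.part).IsDiag

/-- The tree edges at the vertex `v`. -/
def treeAt (v : V) : Finset E :=
  Finset.univ.filter fun e => ¬ ((T.ends e).map T.part).IsDiag ∧ v ∈ T.ends e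

/-- The edges at `v` of the member of the family containing `v`. -/
def memberAt (v : V) : Finset E :=
  (T.Redges (T.part v)).filter fun e => v ∈ T.ends e

def IsCycle (i : Fin T.t) : Prop := ∀ v, T.part v = i → T.toMultigraph.degIn (T.Redges i) v = 2

def IsCubic (i : Fin T.t) : Prop := ∀ v, T.part v = i → T.toMultigraph.degIn (T.Redges i) v = 3

theorem not_isCycle_of_isCubic {i : Fin T.t} (h : T.IsCubic i) : ¬ T.IsCycle i := by
  intro h'
  obtain ⟨v, hv⟩ := T.part_surj i
  have h2 := h' v hv
  have h3 := h v hv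
  omega

theorem isTreeEdge_iff_forall_notMem (e : E) : T.IsTreeEdge e ↔ ∀ i, e ∉ T.Redges i := by
  constructor
  · intro h i hi
    apply h
    have hmem := T.ends_mem_part i e hi
    generalize T.ends e = z at hmem ⊢
    induction z with
    | _ a b => simp [hmem a (by simp), hmem b (by simp)]
  · intro h
    exact (T.edge_cover e).resolve_left (by simpa using h)

theorem sum_incidence (v : V) (f : E → ℤ) :
    ∑ e ∈ T.toMultigraph.incidence v, f e = ∑ e ∈ T.memberAt v, f e + ∑ e ∈ T.treeAt v, f e := by
  classical
  have hdisj : Disjoint (T.memberAt v) (T.treeAt v) := by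
    rw [Finset.disjoint_left]
    intro e he he'
    simp only [memberAt, treeAt, Finset.mem_filter, Finset.mem_univ, true_and] at he he'
    exact (T.isTreeEdge_iff_forall_notMem e).1 he'.1 _ he.1
  rw [← Finset.sum_union hdisj]
  congr 1
  ext e
  simp only [Multigraph.incidence, memberAt, treeAt, Finset.mem_filter, Finset.mem_univ, true_and,
    Finset.mem_union]
  refine ⟨fun h => ?_, by tauto⟩
  rcases T.edge_cover e with ⟨i, hi⟩ | h'
  · exact .inl ⟨T.ends_mem_part i e hi v h ▸ hi, h⟩
  · exact .inr ⟨h', h⟩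

theorem card_incidence (v : V) :
    T.toMultigraph.degree v = (T.memberAt v).card + (T.treeAt v).card := by
  have := T.sum_incidence v 1
  simp only [Pi.one_apply, Finset.sum_const, nsmul_eq_mul, mul_one] at this
  exact_mod_cast this

theorem eq_of_mem_ends_of_part_eq {e : E} (he : T.IsTreeEdge e) {v w : V} (hv : v ∈ T.ends e)
    (hw : w ∈ T.ends e) (h : T.part v = T.part w) : v = w := by
  unfold IsTreeEdge at he
  generalize T.ends e = z at he hv hw
  induction z with
  | _ a b =>
    simp only [Sym2.mem_iff, Sym2.map_mk, Sym2.mk_isDiag_iff] at he hv hw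
    rcases hv with rfl | rfl <;> rcases hw with rfl | rfl <;> simp_all

theorem even_sum_card_treeAt_iff (i : Fin T.t) :
    Even (∑ v with T.part v = i, (T.treeAt v).card) ↔
      (T.IsCycle i ∧ Even (Finset.univ.filter fun v => T.part v = i).card) ∨ T.IsCubic i := by
  classical
  rw [← Finset.card_biUnion]
  · refine Iff.trans (Eq.to_iff ?_) (T.parity i)
    congr 2
    ext e
    simp only [treeAt, Finset.mem_biUnion, Finset.mem_filter, Finset.mem_univ, true_and,
      Sym2.mem_map]
    grind
  · intro v hv w hw hne
    rw [Function.onFun, Finset.disjoint_left]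
    intro e he he'
    simp only [treeAt, Finset.mem_filter, Finset.mem_univ, true_and, Finset.coe_filter,
      Set.mem_ofPred_eq] at he he' hv hw
    exact hne (T.eq_of_mem_ends_of_part_eq he.1 he.2 he'.2 (hv.trans hw.symm))

/-- A deviation `h` of the values of the required function from their means
(`9 / 2` on cycles, `2` on cubic members, `-3` on tree edges), doubled except on the tree edges,
that respects the constraints at the member `i`. -/
structure IsBalancedAt (i : Fin T.t) (h : E → ℤ) : Prop where
  cycle : T.IsCycle i → ∀ e ∈ T.Redges i, h e = 1 ∨ h e = -1
  cubic : T.IsCubic i → ∀ e ∈ T.Redges i, h e = 0 ∨ h e = 2 ∨ h e = -2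
  tree : ∀ e, T.IsTreeEdge e → h e = 1 ∨ h e = -1
  sum_eq : ∀ v, T.part v = i → ∑ e ∈ T.memberAt v, h e + 2 * ∑ e ∈ T.treeAt v, h e = 0

variable {T} in
theorem IsBalancedAt.sign_mul {i : Fin T.t} {h : E → ℤ} (hh : T.IsBalancedAt i h) {c : ℤ}
    (hc : c = 1 ∨ c = -1) : T.IsBalancedAt i fun e => c * h e := by
  rcases hc with rfl | rfl
  · simpa using hh
  · obtain ⟨h1, h2, h3, h4⟩ := hh
    refine ⟨fun hi e he => ?_, fun hi e he => ?_, fun e he => ?_, fun v hv => ?_⟩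
    · have := h1 hi e he; omega
    · have := h2 hi e he; omega
    · have := h3 e he; omega
    · have := h4 v hv
      rw [← Finset.mul_sum, ← Finset.mul_sum]
      linarith

/-- The tree edges at a member can be signed with any prescribed vertex sums that are `0` at the
vertices with an even number of tree edges and `1` or `-1` at the others. -/
theorem exists_treeSign (i : Fin T.t) (s : V → ℤ)
    (hs : ∀ v, T.part v = i → (Even (T.treeAt v).card ∧ s v = 0) ∨
      (¬ Even (T.treeAt v).card ∧ (s v = 1 ∨ s v = -1))) :
    ∃ σ : E → ℤ, (∀ e, σ e = 1 ∨ σ e = -1) ∧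
      ∀ v, T.part v = i → ∑ e ∈ T.treeAt v, σ e = s v := by
  classical
  have key : ∀ v, ∃ σ : E → ℤ, (∀ e, σ e = 1 ∨ σ e = -1) ∧
      (T.part v = i → ∑ e ∈ T.treeAt v, σ e = s v) := by
    intro v
    by_cases hv : T.part v = i
    · obtain ⟨σ, h1, h2⟩ := exists_sign_sum_eq _ _ (hs v hv)
      exact ⟨σ, h1, fun _ => h2⟩
    · exact ⟨1, by simp, fun h => absurd h hv⟩
  choose σ hσ hsum using key
  refine ⟨fun e => if h : ∃ v ∈ T.ends e, T.part v = i then σ h.choose e else 1, fun e => ?_,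
    fun v hv => ?_⟩
  · by_cases h : ∃ v ∈ T.ends e, T.part v = i
    · simpa [h] using hσ _ e
    · simp [h]
  · rw [← hsum v hv]
    refine Finset.sum_congr rfl fun e he => ?_
    simp only [treeAt, Finset.mem_filter, Finset.mem_univ, true_and] at he
    have h : ∃ v ∈ T.ends e, T.part v = i := ⟨v, he.2, hv⟩
    have heq : h.choose = v := T.eq_of_mem_ends_of_part_eq he.1 h.choose_spec.1 he.2
      (h.choose_spec.2.trans hv.symm)
    simp only [h, dif_pos]
    rw [heq]

theorem exists_memberJoin (i : Fin T.t) (S : Finset V) (hS : ∀ v ∈ S, T.part v = i)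
    (heven : Even S.card) :
    ∃ x : E → ℤ, (∀ e, x e = 0 ∨ x e = 1 ∨ x e = -1) ∧
      ∀ v, T.part v = i →
        (v ∈ S → ∑ e ∈ T.memberAt v, x e = 1 ∨ ∑ e ∈ T.memberAt v, x e = -1) ∧
        (v ∉ S → ∑ e ∈ T.memberAt v, x e = 0) := by
  have hjoin : T.toMultigraph.HasSignedJoins (T.Redges i)
      (Finset.univ.filter fun v => T.part v = i) := by
    apply Multigraph.hasSignedJoins_of_reachable
    · intro e he v hv
      simpa using T.ends_mem_part i e he v hv
    · obtain ⟨v, hv⟩ := T.part_surj i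
      exact ⟨v, by simpa using hv⟩
    · intro v hv w hw
      exact T.part_conn i v w (by simpa using hv) (by simpa using hw)
  obtain ⟨x, h1, h2, -, h4⟩ := hjoin S (fun v hv => by simpa using hS v hv) heven
  refine ⟨x, h1, fun v hv => ?_⟩
  have htree : ∑ e ∈ T.treeAt v, x e = 0 := by
    refine Finset.sum_eq_zero fun e he => h2 e ?_
    simp only [treeAt, Finset.mem_filter, Finset.mem_univ, true_and] at he
    exact (T.isTreeEdge_iff_forall_notMem e).1 he.1 i
  simpa [T.sum_incidence, htree] using h4 v

theorem exists_isBalancedAt_of_isCubic {i : Fin T.t} (hi : T.IsCubic i) :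
    ∃ h, T.IsBalancedAt i h := by
  classical
  have hparity := (T.even_sum_card_treeAt_iff i).2 (.inr hi)
  rw [Finset.even_sum_iff_even_card_odd] at hparity
  obtain ⟨x, hx, hsum⟩ := T.exists_memberJoin i _ (by simp +contextual) hparity
  obtain ⟨σ, hσ, hσsum⟩ := T.exists_treeSign i (fun v => -∑ e ∈ T.memberAt v, x e) (by
    intro v hv
    have := hsum v hv
    simp only [Finset.mem_filter, Finset.mem_univ, true_and, hv, ← Nat.not_even_iff_odd] at this
    by_cases h : Even (T.treeAt v).card
    · exact .inl ⟨h, by simpa using this.2 (by simpa using h)⟩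
    · have := this.1 h
      exact .inr ⟨h, by omega⟩)
  have hR : ∀ j, ∀ e ∈ T.Redges j, ¬ T.IsTreeEdge e := fun j e he h =>
    (T.isTreeEdge_iff_forall_notMem e).1 h j he
  refine ⟨fun e => if T.IsTreeEdge e then σ e else 2 * x e,
    fun h => absurd h (T.not_isCycle_of_isCubic hi), fun _ e he => ?_, fun e he => ?_,
    fun v hv => ?_⟩
  · have := hx e
    simp only [hR i e he, if_false]
    omega
  · simpa [he] using hσ e
  · have h1 : ∑ e ∈ T.memberAt v, (if T.IsTreeEdge e then σ e else 2 * x e) =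
        2 * ∑ e ∈ T.memberAt v, x e := by
      rw [Finset.mul_sum]
      exact Finset.sum_congr rfl fun e he => if_neg (hR _ e (Finset.mem_filter.1 he).1)
    have h2 : ∑ e ∈ T.treeAt v, (if T.IsTreeEdge e then σ e else 2 * x e) =
        ∑ e ∈ T.treeAt v, σ e :=
      Finset.sum_congr rfl fun e he => if_pos (Finset.mem_filter.1 he).2.1
    rw [h1, h2, hσsum v hv]
    ring

theorem exists_isBalancedAt_of_isCycle {i : Fin T.t} (hi : T.IsCycle i) :
    ∃ h, T.IsBalancedAt i h := by
  classical
  have hncubic : ¬ T.IsCubic i := fun h => T.not_isCycle_of_isCubic h hi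
  have heven : Even ((Finset.univ.filter fun v => T.part v = i).filter
      fun v => ¬ Odd (T.treeAt v).card).card := by
    have h1 := T.even_sum_card_treeAt_iff i
    rw [Finset.even_sum_iff_even_card_odd] at h1
    have h2 := Finset.card_filter_add_card_filter_not (s := Finset.univ.filter fun v => T.part v = i)
      (fun v => Odd (T.treeAt v).card)
    simp only [hi, true_and, hncubic, or_false] at h1
    rw [← h2, Nat.even_add] at h1
    tauto
  obtain ⟨x, hx, hsum⟩ := T.exists_memberJoin i _ (by simp +contextual) heven
  have hdeg : ∀ v, T.part v = i → ∃ a b, a ≠ b ∧ T.memberAt v = {a, b} := by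
    intro v hv
    have := hi v hv
    subst hv
    exact Finset.card_eq_two.1 this
  obtain ⟨σ, hσ, hσsum⟩ := T.exists_treeSign i (fun v => ∑ e ∈ T.memberAt v, x e ^ 2 - 1) (by
    intro v hv
    have := hsum v hv
    obtain ⟨a, b, hab, hm⟩ := hdeg v hv
    simp only [Finset.mem_filter, Finset.mem_univ, true_and, hv, Nat.not_odd_iff_even, hm,
      Finset.sum_pair hab] at this ⊢
    by_cases h : Even (T.treeAt v).card
    · have := this.1 h
      refine .inl ⟨h, ?_⟩
      rcases hx a with h | h | h <;> rcases hx b with h' | h' | h' <;> simp [h, h'] at this ⊢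
    · have := this.2 h
      refine .inr ⟨h, ?_⟩
      rcases hx a with h | h | h <;> rcases hx b with h' | h' | h' <;> simp [h, h'] at this ⊢)
  have hR : ∀ j, ∀ e ∈ T.Redges j, ¬ T.IsTreeEdge e := fun j e he h =>
    (T.isTreeEdge_iff_forall_notMem e).1 h j he
  refine ⟨fun e => if T.IsTreeEdge e then σ e else 1 - 2 * x e ^ 2,
    fun _ e he => ?_, fun h => absurd h hncubic, fun e he => ?_, fun v hv => ?_⟩
  · simp only [hR i e he, if_false]
    rcases hx e with h | h | h <;> simp [h]
  · simpa [he] using hσ e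
  · have h1 : ∑ e ∈ T.memberAt v, (if T.IsTreeEdge e then σ e else 1 - 2 * x e ^ 2) =
        2 - 2 * ∑ e ∈ T.memberAt v, x e ^ 2 := by
      obtain ⟨a, b, hab, hm⟩ := hdeg v hv
      have hab' : ∀ e ∈ ({a, b} : Finset E), ¬ T.IsTreeEdge e := fun e he =>
        hR _ e (Finset.mem_filter.1 (hm ▸ he : e ∈ T.memberAt v)).1
      rw [hm, Finset.sum_pair hab, Finset.sum_pair hab, if_neg (hab' a (by simp)),
        if_neg (hab' b (by simp))]
      ring
    have h2 : ∑ e ∈ T.treeAt v, (if T.IsTreeEdge e then σ e else 1 - 2 * x e ^ 2) =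
        ∑ e ∈ T.treeAt v, σ e :=
      Finset.sum_congr rfl fun e he => if_pos (Finset.mem_filter.1 he).2.1
    rw [h1, h2, hσsum v hv]
    ring

theorem exists_isBalancedAt (i : Fin T.t) : ∃ h, T.IsBalancedAt i h :=
  (T.cycle_or_cubic i).elim T.exists_isBalancedAt_of_isCycle T.exists_isBalancedAt_of_isCubic

/-- On a tree every `ZMod 2`-valued function on the edges is a coboundary. -/
theorem exists_coboundary_eq (a b : E → V) (hab : ∀ e, T.ends e = s(a e, b e)) (τ : E → ZMod 2) :
    ∃ c : Fin T.t → ZMod 2, ∀ e, T.IsTreeEdge e → c (T.part (a e)) + c (T.part (b e)) = τ e := by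
  classical
  let δ : (Fin T.t → ZMod 2) →ₗ[ZMod 2] ({e // T.IsTreeEdge e} → ZMod 2) :=
    { toFun := fun c e => c (T.part (a e)) + c (T.part (b e))
      map_add' := by intro c d; ext e; simp only [Pi.add_apply]; ring
      map_smul' := by intro r c; ext e; simp [mul_add] }
  have hconst : ∀ c ∈ LinearMap.ker δ, ∀ i j, c i = c j := by
    intro c hc i j
    induction T.quot_conn i j with
    | refl => rfl
    | tail _ hstep ih =>
      obtain ⟨hne, e, he⟩ := hstep
      rw [ih]
      have htree : T.IsTreeEdge e := by simpa [IsTreeEdge, he] using hne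
      have h0 : c (T.part (a e)) + c (T.part (b e)) = 0 :=
        congrFun (LinearMap.mem_ker.1 hc) ⟨e, htree⟩
      have h1 : c (T.part (a e)) = c (T.part (b e)) := CharTwo.add_eq_zero.1 h0
      rw [hab, Sym2.map_mk, Sym2.eq_iff] at he
      rcases he with ⟨h, h'⟩ | ⟨h, h'⟩
      · rw [← h, ← h', h1]
      · rw [← h, ← h', h1]
  have hker : Module.finrank (ZMod 2) (LinearMap.ker δ) ≤ 1 := by
    refine (Submodule.finrank_mono (t := Submodule.span (ZMod 2) {1}) ?_).trans
      ((finrank_span_le_card _).trans (by simp))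
    intro c hc
    rw [Submodule.mem_span_singleton]
    exact ⟨c ⟨0, T.t_pos⟩, by ext j; simpa using hconst c hc _ _⟩
  have hcard : Fintype.card {e // T.IsTreeEdge e} = T.t - 1 := by
    rw [Fintype.card_subtype, ← T.quot_tree]
    simp only [IsTreeEdge]
    congr
  have hrank := LinearMap.finrank_range_add_finrank_ker δ
  rw [Module.finrank_fin_fun] at hrank
  have htop : LinearMap.range δ = ⊤ := by
    apply Submodule.eq_top_of_finrank_eq
    refine (Submodule.finrank_le _).antisymm ?_
    rw [Module.finrank_fintype_fun_eq_card, hcard]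
    omega
  obtain ⟨c, hc⟩ := LinearMap.range_eq_top.1 htop fun e => τ e
  exact ⟨c, fun e he => congrFun hc ⟨e, he⟩⟩

theorem exists_forall_isBalancedAt : ∃ h, ∀ i, T.IsBalancedAt i h := by
  classical
  choose h hh using T.exists_isBalancedAt
  have hends : ∀ e, ∃ a b, T.ends e = s(a, b) := fun e => by
    induction T.ends e with
    | _ a b => exact ⟨a, b, rfl⟩
  choose a b hab using hends
  obtain ⟨c, hc⟩ := T.exists_coboundary_eq a b hab
    fun e => if h (T.part (a e)) e = h (T.part (b e)) e then 0 else 1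
  let γ : Fin T.t → ℤ := fun i => if c i = 0 then 1 else -1
  have hγ : ∀ i, γ i = 1 ∨ γ i = -1 := fun i => by
    by_cases hi : c i = 0 <;> simp [γ, hi]
  have hglue : ∀ e, ∀ v ∈ T.ends e,
      γ (T.part (a e)) * h (T.part (a e)) e = γ (T.part v) * h (T.part v) e := by
    intro e v hv
    rw [hab, Sym2.mem_iff] at hv
    obtain rfl | rfl := hv
    · rfl
    by_cases he : T.IsTreeEdge e
    · have h1 := (hh (T.part (a e))).tree e he
      have h2 := (hh (T.part (b e))).tree e he
      have h3 := hc e he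
      have hbit : ∀ z : ZMod 2, z = 0 ∨ z = 1 := by decide
      rcases h1 with h1 | h1 <;> rcases h2 with h2 | h2 <;>
      rcases hbit (c (T.part (a e))) with h4 | h4 <;>
      rcases hbit (c (T.part (b e))) with h5 | h5 <;>
      simp [γ, h1, h2, h4, h5, CharTwo.add_self_eq_zero] at h3 ⊢
    · have : T.part (a e) = T.part (b e) := by simpa [IsTreeEdge, hab] using he
      rw [this]
  refine ⟨fun e => γ (T.part (a e)) * h (T.part (a e)) e, fun i => ?_⟩
  have hR : ∀ e ∈ T.Redges i, T.part (a e) = i := fun e he =>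
    T.ends_mem_part i e he _ (by simp [hab])
  obtain ⟨h1, h2, -, h4⟩ := (hh i).sign_mul (hγ i)
  refine ⟨fun hi e he => ?_, fun hi e he => ?_,
    fun e he => ((hh _).sign_mul (hγ _)).tree e he, fun v hv => ?_⟩
  · simpa only [hR e he] using h1 hi e he
  · simpa only [hR e he] using h2 hi e he
  · rw [← h4 v hv]
    congr 1
    · exact Finset.sum_congr rfl fun e he => hv ▸ hglue e v (Finset.mem_filter.1 he).2
    · congr 1
      exact Finset.sum_congr rfl fun e he => hv ▸ hglue e v (Finset.mem_filter.1 he).2.2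

end CycleCubicTree

/-- Every cycle-cubic tree with maximum degree at most 5 admits an integer
function on its edges taking values in `{4,5}` on edges of cycle members, in
`{1,2,3}` on edges of cubic members, in `{-2,-4}` on the remaining edges, whose
sum over the edges incident with each vertex `u` is `0, 3, 6, 9` according as
`deg u = 5, 4, 3, 2`. -/
theorem cycleCubicTree_admits_function
    {V E : Type*} [Fintype V] [Fintype E] [DecidableEq V]
    (T : CycleCubicTree V E) (hmax : ∀ v, T.toMultigraph.degree v ≤ 5) :
    ∃ f : E → ℤ,
      (∀ i, ∀ e ∈ T.Redges i,
        ((∀ v, T.part v = i → T.toMultigraph.degIn (T.Redges i) v = 2) →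
          f e = 4 ∨ f e = 5) ∧
        ((∀ v, T.part v = i → T.toMultigraph.degIn (T.Redges i) v = 3) →
          f e = 1 ∨ f e = 2 ∨ f e = 3)) ∧
      (∀ e, (∀ i, e ∉ T.Redges i) → f e = -2 ∨ f e = -4) ∧
      (∀ u,
        (T.toMultigraph.degree u = 5 →
          ∑ e ∈ T.toMultigraph.incidence u, f e = 0) ∧
        (T.toMultigraph.degree u = 4 →
          ∑ e ∈ T.toMultigraph.incidence u, f e = 3) ∧
        (T.toMultigraph.degree u = 3 →
          ∑ e ∈ T.toMultigraph.incidence u, f e = 6) ∧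
        (T.toMultigraph.degree u = 2 →
          ∑ e ∈ T.toMultigraph.incidence u, f e = 9)) := by
  classical
  obtain ⟨h, hh⟩ := T.exists_forall_isBalancedAt
  have hR : ∀ i, ∀ e ∈ T.Redges i, ¬ T.IsTreeEdge e := fun i e he h =>
    (T.isTreeEdge_iff_forall_notMem e).1 h i he
  let f : E → ℤ := fun e =>
    if T.IsTreeEdge e then h e - 3
    else if ∃ i, T.IsCycle i ∧ e ∈ T.Redges i then (9 + h e) / 2
    else (4 + h e) / 2
  have hcycle : ∀ i, T.IsCycle i → ∀ e ∈ T.Redges i, 2 * f e = 9 + h e := by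
    intro i hi e he
    have hex : ∃ i, T.IsCycle i ∧ e ∈ T.Redges i := ⟨i, hi, he⟩
    have := (hh i).cycle hi e he
    simp only [f, hR i e he, hex, if_true, if_false]
    omega
  have hcubic : ∀ i, T.IsCubic i → ∀ e ∈ T.Redges i, 2 * f e = 4 + h e := by
    intro i hi e he
    have hex : ¬ ∃ i, T.IsCycle i ∧ e ∈ T.Redges i := by
      rintro ⟨j, hj, hje⟩
      obtain ⟨v, hv⟩ : ∃ v, v ∈ T.ends e := ⟨_, Sym2.out_fst_mem _⟩
      obtain rfl : i = j := (T.ends_mem_part i e he v hv).symm.trans (T.ends_mem_part j e hje v hv)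
      exact T.not_isCycle_of_isCubic hi hj
    have := (hh i).cubic hi e he
    simp only [f, hR i e he, hex, if_false]
    omega
  have htree : ∀ e, T.IsTreeEdge e → f e = h e - 3 := fun e he => if_pos he
  have hsum : ∀ u, ∑ e ∈ T.toMultigraph.incidence u, f e = 15 - 3 * T.toMultigraph.degree u := by
    intro u
    have hbal := (hh (T.part u)).sum_eq u rfl
    have h1 : ∑ e ∈ T.treeAt u, f e = ∑ e ∈ T.treeAt u, h e - 3 * (T.treeAt u).card := by
      rw [Finset.sum_congr rfl fun e he => htree e (Finset.mem_filter.1 he).2.1,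
        Finset.sum_sub_distrib, Finset.sum_const, nsmul_eq_mul, mul_comm]
    rw [T.sum_incidence, T.card_incidence, h1]
    have h2 : ∀ m : ℤ, (∀ e ∈ T.memberAt u, 2 * f e = m + h e) →
        2 * ∑ e ∈ T.memberAt u, f e = (T.memberAt u).card * m + ∑ e ∈ T.memberAt u, h e := by
      intro m hm
      rw [Finset.mul_sum, Finset.sum_congr rfl hm, Finset.sum_add_distrib, Finset.sum_const,
        nsmul_eq_mul]
    rcases T.cycle_or_cubic (T.part u) with hi | hi
    · have h3 := h2 9 fun e he => hcycle _ hi e (Finset.mem_filter.1 he).1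
      have hcard : (T.memberAt u).card = 2 := hi u rfl
      rw [hcard] at h3 ⊢
      push_cast at h3 ⊢
      linarith
    · have h3 := h2 4 fun e he => hcubic _ hi e (Finset.mem_filter.1 he).1
      have hcard : (T.memberAt u).card = 3 := hi u rfl
      rw [hcard] at h3 ⊢
      push_cast at h3 ⊢
      linarith
  refine ⟨f, fun i e he => ⟨fun hi => ?_, fun hi => ?_⟩, fun e he => ?_, fun u => ?_⟩
  · have := (hh i).cycle hi e he
    have := hcycle i hi e he
    omega
  · have := (hh i).cubic hi e he
    have := hcubic i hi e he
    omega
  · have he' := (T.isTreeEdge_iff_forall_notMem e).2 he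
    have := (hh ⟨0, T.t_pos⟩).tree e he'
    have := htree e he'
    omega
  · rw [hsum]
    refine ⟨?_, ?_, ?_, ?_⟩ <;> intro hu <;> rw [hu] <;> norm_num
end

section
/- Every 5-regular graph that contains a 2-factor admits a zero-sum 4-flow, and hence a zero-sum 6-flow. -/
namespace Multigraph

/-- A zero-sum `k`-flow is a zero-sum `l`-flow for every `l ≥ k`. -/
theorem IsZeroSumKFlow.mono {V E : Type*} [Fintype E] [DecidableEq V] {G : Multigraph V E}
    {k l : ℕ} (hkl : k ≤ l) {f : E → ℤ} (hf : G.IsZeroSumKFlow k f) : G.IsZeroSumKFlow l f :=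
  ⟨hf.1, fun e => (hf.2 e).trans (by omega)⟩

/-- The sum at `v` of the function equal to `a` on `F` and `b` off `F`. -/
theorem sum_incidence_ite {V E : Type*} [Fintype E] [DecidableEq V] (G : Multigraph V E)
    (F : Finset E) [DecidablePred (· ∈ F)] (a b : ℤ) (v : V) :
    ∑ e ∈ G.incidence v, (if e ∈ F then a else b) =
      G.degIn F v * a + (G.degree v - G.degIn F v) * b := by
  have hF : (G.incidence v).filter (· ∈ F) = F.filter fun e => v ∈ G.ends e := by
    ext e
    simp [incidence, and_comm]
  have hcard := Finset.card_filter_add_card_filter_not (s := G.incidence v) (· ∈ F)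
  rw [hF] at hcard
  rw [Finset.sum_ite, Finset.sum_const, Finset.sum_const, hF, nsmul_eq_mul, nsmul_eq_mul,
    degree, degIn, ← hcard]
  push_cast
  ring

end Multigraph

/-- Every 5-regular graph containing a 2-factor admits a zero-sum 4-flow, and
hence a zero-sum 6-flow. -/
theorem five_regular_with_two_factor_admits_zero_sum_four_flow
    {V E : Type*} [Fintype V] [Fintype E] [DecidableEq V]
    (G : Multigraph V E) (hreg : ∀ v, G.degree v = 5)
    (F : Finset E) (h2 : ∀ v, G.degIn F v = 2) :
    (∃ f : E → ℤ, G.IsZeroSumKFlow 4 f) ∧ ∃ f : E → ℤ, G.IsZeroSumKFlow 6 f := by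
  classical
  have hf : G.IsZeroSumKFlow 4 (fun e => if e ∈ F then 3 else -2) := by
    refine ⟨⟨fun e => ?_, fun v => ?_⟩, fun e => ?_⟩
    · dsimp only
      split_ifs <;> norm_num
    · rw [G.sum_incidence_ite, hreg, h2]
      norm_num
    · dsimp only
      split_ifs <;> norm_num
  exact ⟨⟨_, hf⟩, _, hf.mono (by norm_num)⟩
end

section
/- Let G be a 5-regular graph with a spanning subgraph H = H_1 ∪ H_2, where H_1 and H_2 are vertex-disjoint, H_1 is 2-regular and H_2 is 3-regular. Then the number of connected components of H_1 that are odd cycles is even. -/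
namespace Multigraph

variable {V E : Type*} [DecidableEq V]

/-- The handshake lemma for a vertex set `B` that no edge of `F` leaves. -/
theorem even_sum_degIn [Fintype E] (G : Multigraph V E) (F : Finset E) (B : Finset V)
    (h : ∀ e ∈ F, (∀ v ∈ G.ends e, v ∈ B) ∨ ∀ v ∈ G.ends e, v ∉ B) :
    Even (∑ v ∈ B, G.degIn F v) := by
  simp only [degIn, Finset.card_filter]
  rw [Finset.sum_comm]
  refine Finset.even_sum _ fun e he => ?_
  rw [← Finset.card_filter]
  rcases h e he with h | h
  · have hB : B.filter (· ∈ G.ends e) = (G.ends e).toFinset := by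
      ext v
      simpa using h v
    rw [hB, Sym2.card_toFinset_of_not_isDiag _ (G.loopless e)]
    exact even_two
  · have hB : B.filter (· ∈ G.ends e) = ∅ :=
      Finset.filter_eq_empty_iff.2 fun v hv hve => h v hve hv
    simp [hB]

/-- If all degrees in `F` of the vertices of `B` equal an odd number `k`, and no edge of `F`
leaves `B`, then `B` has even size. -/
theorem even_card_of_degIn_eq_odd [Fintype E] (G : Multigraph V E) (F : Finset E) (B : Finset V)
    (h : ∀ e ∈ F, (∀ v ∈ G.ends e, v ∈ B) ∨ ∀ v ∈ G.ends e, v ∉ B)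
    {k : ℕ} (hk : Odd k) (hdeg : ∀ v ∈ B, G.degIn F v = k) : Even B.card := by
  have hsum := G.even_sum_degIn F B h
  rw [Finset.sum_const_nat hdeg, Nat.even_mul] at hsum
  exact hsum.resolve_right (Nat.not_even_iff_odd.2 hk)

end Multigraph

/-- A vertex set closed under adjacency is closed under reachability. -/
theorem SimpleGraph.Reachable.mem_of_adj_closed {V : Type*} {H : SimpleGraph V} {A : Set V}
    (hA : ∀ v w, H.Adj v w → v ∈ A → w ∈ A) {v w : V} (h : H.Reachable v w) (hv : v ∈ A) :
    w ∈ A := by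
  obtain ⟨p⟩ := h
  induction p with
  | nil => exact hv
  | cons hadj _ ih => exact ih (hA _ _ hadj hv)

/-- In a vertex set of even size that is closed under adjacency, the number of components of odd
size is even. -/
theorem SimpleGraph.even_ncard_odd_components {V : Type*} (H : SimpleGraph V) (A : Finset V)
    (hA : ∀ v w, H.Adj v w → v ∈ A → w ∈ A) (hcard : Even A.card) :
    Even (Set.ncard {c : H.ConnectedComponent |
      (∃ v ∈ A, H.connectedComponentMk v = c) ∧
        Odd (Set.ncard {v | H.connectedComponentMk v = c})}) := by
  classical
  have hfib : ∀ c ∈ A.image H.connectedComponentMk,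
      Set.ncard {v | H.connectedComponentMk v = c} =
        (A.filter fun v => H.connectedComponentMk v = c).card := by
    intro c hc
    obtain ⟨a, ha, rfl⟩ := Finset.mem_image.1 hc
    rw [← Set.ncard_coe_finset]
    congr 1
    ext v
    simp only [Set.mem_ofPred_eq, Finset.coe_filter]
    refine ⟨fun h => ⟨?_, h⟩, And.right⟩
    exact (SimpleGraph.ConnectedComponent.eq.1 h).symm.mem_of_adj_closed (A := A) hA ha
  rw [Finset.card_eq_sum_card_image H.connectedComponentMk A,
    Finset.even_sum_iff_even_card_odd] at hcard
  convert hcard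
  rw [← Set.ncard_coe_finset]
  congr 1
  ext c
  simp only [Set.mem_ofPred_eq, Finset.coe_filter, Finset.mem_image]
  refine and_congr_right fun hc => ?_
  rw [hfib c (Finset.mem_image.2 hc)]

/-- Let `G` be a 5-regular graph with a spanning subgraph `H` (edge set `F`)
which is the vertex-disjoint union of a 2-regular part `H₁` on the vertex set
`A` and a 3-regular part on the complement of `A`.  Then the number of
connected components of `H₁` that are odd cycles (i.e. the components of `H`
meeting `A`, which are cycles, having an odd number of vertices) is even. -/
theorem even_number_of_odd_cycles
    {V E : Type*} [Fintype V] [Fintype E] [DecidableEq V]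
    (G : Multigraph V E) (hreg : ∀ v, G.degree v = 5)
    (F : Finset E) (A : Finset V)
    (h2 : ∀ v ∈ A, G.degIn F v = 2)
    (h3 : ∀ v ∉ A, G.degIn F v = 3)
    (hsep : ∀ e ∈ F, (∀ v ∈ G.ends e, v ∈ A) ∨ ∀ v ∈ G.ends e, v ∉ A) :
    Even (Set.ncard
      {c : (G.supportGraph ↑F).ConnectedComponent |
        (∃ v ∈ A, (G.supportGraph ↑F).connectedComponentMk v = c) ∧
        Odd (Set.ncard {v | (G.supportGraph ↑F).connectedComponentMk v = c})}) := by
  have hV : Even (Finset.univ : Finset V).card :=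
    G.even_card_of_degIn_eq_odd Finset.univ Finset.univ (by simp) (by decide : Odd 5)
      fun v _ => hreg v
  have hAc : Even Aᶜ.card :=
    G.even_card_of_degIn_eq_odd F Aᶜ (by simpa [or_comm] using hsep) (by decide : Odd 3)
      fun v hv => h3 v (Finset.mem_compl.1 hv)
  refine SimpleGraph.even_ncard_odd_components _ A ?_ ?_
  · rintro v w ⟨-, e, he, hends⟩ hv
    rcases hsep e he with h | h
    · exact h w (by simp [hends])
    · exact absurd hv (h v (by simp [hends]))
  · rw [Finset.card_univ, ← Finset.card_add_card_compl A] at hV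
    exact (Nat.even_add.1 hV).2 hAc
end

section
/- Let G be a 5-regular graph with a spanning subgraph H = H_1 ∪ H_2, where H_1 and H_2 are vertex-disjoint, H_1 is 2-regular, H_2 is 3-regular, and every connected component of H_1 is an even cycle. Then G admits a zero-sum 6-flow. -/
namespace Multigraph

variable {V E : Type*}

lemma mem_iff_of_reachable (G : Multigraph V E) {F : Set E} {A : Set V}
    (hsep : ∀ e ∈ F, (∀ v ∈ G.ends e, v ∈ A) ∨ ∀ v ∈ G.ends e, v ∉ A) {v w : V}
    (h : (G.supportGraph F).Reachable v w) : v ∈ A ↔ w ∈ A := by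
  obtain ⟨p⟩ := h
  induction p with
  | nil => rfl
  | cons hadj _ ih =>
    obtain ⟨-, e, he, hends⟩ := hadj
    rw [← ih]
    rcases hsep e he with h | h <;> simp only [hends, Sym2.mem_iff, forall_eq_or_imp, forall_eq] at h
      <;> tauto

lemma eq_of_reachable (G : Multigraph V E) {F : Set E} {α : Type*} {y : V → α}
    (hy : ∀ e ∈ F, ∀ u v, G.ends e = s(u, v) → y u = y v) {v w : V}
    (h : (G.supportGraph F).Reachable v w) : y v = y w := by
  obtain ⟨p⟩ := h
  induction p with
  | nil => rfl
  | cons hadj _ ih =>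
    obtain ⟨-, e, he, hends⟩ := hadj
    exact (hy e he _ _ hends).trans ih

/-- If every component of the subgraph with edge set `F` has evenly many vertices in `T`,
then that subgraph has a `T`-join, given here by its characteristic function mod 2. -/
lemma exists_join [Fintype V] [DecidableEq V] (G : Multigraph V E) (F : Finset E) (T : Finset V)
    (hT : ∀ v ∈ T, Even (Set.ncard {w | w ∈ T ∧ (G.supportGraph ↑F).Reachable v w})) :
    ∃ c : E → ZMod 2, ∀ v, ∑ e ∈ F with v ∈ G.ends e, c e = if v ∈ T then 1 else 0 := by
  classical
  let L : (E → ZMod 2) →ₗ[ZMod 2] (V → ZMod 2) :=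
    LinearMap.pi fun v => ∑ e ∈ F with v ∈ G.ends e, LinearMap.proj e
  have hL : ∀ c v, L c v = ∑ e ∈ F with v ∈ G.ends e, c e := fun c v => by
    simp [L, LinearMap.sum_apply]
  suffices h : (fun v => if v ∈ T then (1 : ZMod 2) else 0) ∈ LinearMap.range L by
    obtain ⟨c, hc⟩ := h
    exact ⟨c, fun v => by rw [← hL, hc]⟩
  by_contra hmem
  obtain ⟨φ, hφ, hker⟩ := Submodule.exists_le_ker_of_notMem hmem
  set y : V → ZMod 2 := fun v => φ (Pi.single v 1) with hydef
  have hφsum : φ (fun v => if v ∈ T then (1 : ZMod 2) else 0) = ∑ v ∈ T, y v := by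
    rw [hydef, ← map_sum]
    congr 1
    ext v
    simp [Finset.sum_apply, Pi.single_apply]
  have hy : ∀ e ∈ (F : Set E), ∀ u v, G.ends e = s(u, v) → y u = y v := by
    intro e he u v hends
    have huv : u ≠ v := by
      rintro rfl
      exact G.loopless e (by simp [hends])
    have hsingle : L (Pi.single e 1) = Pi.single u 1 + Pi.single v 1 := by
      ext w
      rw [hL]
      by_cases hwu : w = u
      · subst hwu
        simp [Pi.single_apply, huv, hends, Finset.mem_coe.1 he]
      · by_cases hwv : w = v
        · subst hwv
          simp [Pi.single_apply, hwu, hends, Finset.mem_coe.1 he]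
        · simp [Pi.single_apply, hwu, hwv, hends]
    have h0 : φ (L (Pi.single e 1)) = 0 := hker ⟨_, rfl⟩
    rw [hsingle, map_add] at h0
    exact CharTwo.add_eq_zero.1 h0
  apply hφ
  rw [hφsum, ← Finset.sum_fiberwise T (G.supportGraph ↑F).connectedComponentMk]
  refine Finset.sum_eq_zero fun C _ => ?_
  induction C using SimpleGraph.ConnectedComponent.ind with | _ v
  obtain hempty | ⟨u, hu⟩ := (T.filter fun w =>
    (G.supportGraph ↑F).connectedComponentMk w =
      (G.supportGraph ↑F).connectedComponentMk v).eq_empty_or_nonempty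
  · rw [hempty, Finset.sum_empty]
  · obtain ⟨huT, huv⟩ := Finset.mem_filter.1 hu
    rw [← huv, Finset.sum_congr rfl fun w hw =>
      (G.eq_of_reachable hy (SimpleGraph.ConnectedComponent.eq.1 (Finset.mem_filter.1 hw).2)),
      Finset.sum_const, nsmul_eq_mul]
    have hcard := hT u huT
    have hset : {w | w ∈ T ∧ (G.supportGraph ↑F).Reachable u w} = ↑(T.filter fun w =>
        (G.supportGraph ↑F).connectedComponentMk w =
          (G.supportGraph ↑F).connectedComponentMk u) := by
      ext w
      simp [SimpleGraph.ConnectedComponent.eq, SimpleGraph.reachable_comm]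
    rw [hset, Set.ncard_coe_finset] at hcard
    rw [(ZMod.natCast_eq_zero_iff_even).2 hcard, zero_mul]

end Multigraph

/-- Let `G` be a 5-regular graph with a spanning subgraph `H` (edge set `F`)
which is the vertex-disjoint union of a 2-regular part `H₁` on the vertex set
`A` and a 3-regular part on the complement of `A`, and suppose every connected
component of `H₁` is an even cycle (i.e. the component of each `v ∈ A` has an
even number of vertices).  Then `G` admits a zero-sum 6-flow. -/
theorem five_regular_even_cycles_case_admits_zero_sum_six_flow
    {V E : Type*} [Fintype V] [Fintype E] [DecidableEq V]
    (G : Multigraph V E) (hreg : ∀ v, G.degree v = 5)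
    (F : Finset E) (A : Finset V)
    (h2 : ∀ v ∈ A, G.degIn F v = 2)
    (h3 : ∀ v ∉ A, G.degIn F v = 3)
    (hsep : ∀ e ∈ F, (∀ v ∈ G.ends e, v ∈ A) ∨ ∀ v ∈ G.ends e, v ∉ A)
    (heven : ∀ v ∈ A,
      Even (Set.ncard {w | (G.supportGraph ↑F).Reachable v w})) :
    ∃ f : E → ℤ, G.IsZeroSumKFlow 6 f := by
  classical
  obtain ⟨c, hc⟩ := G.exists_join F A fun v hv => by
    convert heven v hv using 4 with w
    exact and_iff_right_of_imp fun h =>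
      (G.mem_iff_of_reachable (A := (A : Set V)) (by simpa using hsep) h).1 hv
  let f : E → ℤ := fun e =>
    if e ∈ F then if ∀ v ∈ G.ends e, v ∈ A then if c e = 0 then -4 else -5 else -2 else 3
  refine ⟨f, ⟨fun e => ?_, fun v => ?_⟩, fun e => ?_⟩
  · simp only [f]
    split_ifs <;> norm_num
  · have hsplit := Finset.sum_filter_add_sum_filter_not (G.incidence v) (· ∈ F) f
    have hcard := Finset.card_filter_add_card_filter_not (s := G.incidence v) (· ∈ F)
    have hin : (G.incidence v).filter (· ∈ F) = F.filter fun e => v ∈ G.ends e := by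
      ext e
      simp [Multigraph.incidence, and_comm]
    have hout : ∑ e ∈ G.incidence v with e ∉ F, f e =
        3 * ((G.incidence v).filter (· ∉ F)).card := by
      rw [Finset.sum_congr rfl fun e he => if_neg (Finset.mem_filter.1 he).2,
        Finset.sum_const, nsmul_eq_mul, mul_comm]
    have hdeg : (G.incidence v).card = 5 := hreg v
    rw [hin] at hsplit hcard
    rw [← hsplit, hout]
    by_cases hv : v ∈ A
    · have hF : ∀ e ∈ F.filter fun e => v ∈ G.ends e, f e = if c e = 0 then -4 else -5 := by
        intro e he
        obtain ⟨heF, hve⟩ := Finset.mem_filter.1 he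
        have hA := (hsep e heF).resolve_right fun h => h v hve hv
        rw [show f e = _ from if_pos heF, if_pos hA]
      have hdegF : (F.filter fun e => v ∈ G.ends e).card = 2 := h2 v hv
      have hcv := hc v
      rw [if_pos hv] at hcv
      rw [Finset.sum_congr rfl hF]
      obtain ⟨a, b, hab, hpair⟩ := Finset.card_eq_two.1 hdegF
      rw [hpair, Finset.sum_pair hab] at hcv ⊢
      have hval : ∀ x y : ZMod 2, x + y = 1 →
          (if x = 0 then (-4 : ℤ) else -5) + (if y = 0 then -4 else -5) = -9 := by decide
      rw [hval _ _ hcv]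
      omega
    · have hF : ∀ e ∈ F.filter fun e => v ∈ G.ends e, f e = -2 := by
        intro e he
        obtain ⟨heF, hve⟩ := Finset.mem_filter.1 he
        rw [show f e = _ from if_pos heF, if_neg fun h => hv (h v hve)]
      have hdegF : (F.filter fun e => v ∈ G.ends e).card = 3 := h3 v hv
      rw [Finset.sum_congr rfl hF, Finset.sum_const, hdegF]
      simp only [nsmul_eq_mul]
      omega
  · simp only [f]
    split_ifs <;> norm_num
end
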